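/- arXiv:2503.10826 — 2 statements merged into one kernel-verified Lean document; each statement's English description precedes it below -/
import Mathlib

section
/- Let a, r, k, m be positive integers with gcd(a, m) = gcd(r, m) = 1, a^k ≡ 1 (mod m), r^k ≡ 1 (mod m), and r ≢ 1 (mod m). Then C_m(X) = 1 + X + ⋯ + X^{m−1} divides ∏_{i=0}^{k−1} (X^{a·r^i} − 1) − ∏_{i=0}^{k−1} (X^{r^i} − 1) in ℤ[X] if and only if one of the following holds: a is congruent modulo m to a power of r (i.e., ∃ i, a ≡ r^i (mod m)); or −a is congruent modulo m to a power of r, k is even, and m divides 1 + r + r² + ⋯ + r^{k−1}. -/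
open Polynomial

open Finset Filter Topology in
theorem tendsto_sum_mul_of_bounded_partial_sums {c : ℕ → ℂ} {u : ℕ → ℝ} {B : ℝ}
    (hB : ∀ n, ‖∑ i ∈ range n, c i‖ ≤ B) (hu0 : Tendsto u atTop (𝓝 0))
    (hs : Summable fun i ↦ (∑ j ∈ range (i + 1), c j) * ((u i - u (i + 1) : ℝ) : ℂ)) :
    Tendsto (fun n ↦ ∑ i ∈ range n, c i * (u i : ℂ)) atTop
      (𝓝 (∑' i, (∑ j ∈ range (i + 1), c j) * ((u i - u (i + 1) : ℝ) : ℂ))) := by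
  have key : ∀ n, ∑ i ∈ range n, c i * (u i : ℂ) = u n • (∑ i ∈ range n, c i) +
      ∑ i ∈ range n, (∑ j ∈ range (i + 1), c j) * ((u i - u (i + 1) : ℝ) : ℂ) := by
    intro n
    induction n with
    | zero => simp
    | succ n ih =>
      rw [sum_range_succ, ih, sum_range_succ (fun i ↦ (∑ j ∈ range (i + 1), c j) * _),
        sum_range_succ c]
      simp only [Complex.real_smul]
      push_cast
      ring
  simp_rw [key]
  have h0 : Tendsto (fun n ↦ u n • (∑ i ∈ range n, c i)) atTop (𝓝 0) :=
    NormedField.tendsto_zero_smul_of_tendsto_zero_of_bounded hu0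
      ⟨B, eventually_map.mpr <| Eventually.of_forall hB⟩
  simpa using h0.add hs.hasSum.tendsto_sum_nat

theorem ZMod.sum_range_natCast {M : Type*} [AddCommMonoid M] {N : ℕ} [NeZero N]
    (g : ZMod N → M) : ∑ j ∈ Finset.range N, g j = ∑ a, g a :=
  Finset.sum_nbij' (fun j ↦ (j : ZMod N)) ZMod.val (by simp)
    (by simp [ZMod.val_lt]) (fun j hj ↦ ZMod.val_cast_of_lt (Finset.mem_range.mp hj))
    (by simp) (by simp)

theorem ZMod.exists_norm_sum_range_le {N : ℕ} [NeZero N] {Φ : ZMod N → ℂ}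
    (hΦ : ∑ a, Φ a = 0) :
    ∃ B : ℝ, ∀ n, ‖∑ i ∈ Finset.range n, Φ ((i + 1 : ℕ) : ZMod N)‖ ≤ B := by
  set S : ℕ → ℂ := fun n ↦ ∑ i ∈ Finset.range n, Φ ((i + 1 : ℕ) : ZMod N) with hS
  have hper : Function.Periodic S N := by
    intro n
    simp only [hS, Finset.sum_range_add, add_eq_left]
    have := ZMod.sum_range_natCast (fun a : ZMod N ↦ Φ (a + (n + 1)))
    have hshift : ∑ a, Φ (a + (n + 1)) = 0 :=
      (Equiv.sum_comp (Equiv.addRight ((n : ZMod N) + 1)) Φ).trans hΦ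
    rw [← hshift, ← this]
    refine Finset.sum_congr rfl fun j _ ↦ ?_
    push_cast
    ring_nf
  refine ⟨∑ i ∈ Finset.range N, ‖S i‖, fun n ↦ ?_⟩
  change ‖S n‖ ≤ _
  rw [← hper.map_mod_nat n]
  exact Finset.single_le_sum (f := fun i ↦ ‖S i‖) (fun _ _ ↦ norm_nonneg _)
    (Finset.mem_range.mpr (Nat.mod_lt n (NeZero.pos N)))

theorem rpow_neg_sub_rpow_neg_mem_Icc {x s : ℝ} (hx : 1 ≤ x) (hs : 1 ≤ s) (hs2 : s ≤ 2) :
    x ^ (-s) - (x + 1) ^ (-s) ∈ Set.Icc 0 (2 * (1 / x ^ 2)) := by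
  have hx0 : 0 < x := by linarith
  constructor
  · rw [sub_nonneg]
    exact Real.rpow_le_rpow_of_nonpos hx0 (by linarith) (by linarith)
  · have h1 : (x + 1) ^ (-s) = x ^ (-s) * (x / (x + 1)) ^ s := by
      rw [Real.div_rpow hx0.le (by linarith), Real.rpow_neg hx0.le, Real.rpow_neg (by linarith)]
      have := (Real.rpow_pos_of_pos hx0 s).ne'
      field_simp
    have h2 : (x / (x + 1)) ^ (2 : ℝ) ≤ (x / (x + 1)) ^ s :=
      Real.rpow_le_rpow_of_exponent_ge (by positivity)
        ((div_le_one (by linarith)).mpr (by linarith)) hs2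
    have h3 : x ^ (-s) ≤ x ^ (-1 : ℝ) := Real.rpow_le_rpow_of_exponent_le hx (by linarith)
    rw [Real.rpow_two] at h2
    rw [Real.rpow_neg_one] at h3
    have h4 : (x / (x + 1)) ^ 2 ≤ 1 :=
      pow_le_one₀ (by positivity) ((div_le_one (by linarith)).mpr (by linarith))
    calc x ^ (-s) - (x + 1) ^ (-s) = x ^ (-s) * (1 - (x / (x + 1)) ^ s) := by rw [h1]; ring
      _ ≤ x ^ (-s) * (1 - (x / (x + 1)) ^ 2) := by
          gcongr
      _ ≤ x⁻¹ * (1 - (x / (x + 1)) ^ 2) := by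
          apply mul_le_mul_of_nonneg_right h3; linarith
      _ ≤ 2 * (1 / x ^ 2) := by
          rw [inv_mul_eq_div, div_le_iff₀ hx0, ← sub_nonneg]
          have : 2 * (1 / x ^ 2) * x - (1 - (x / (x + 1)) ^ 2) = (3 * x + 2) / (x * (x + 1) ^ 2) := by
            field_simp; ring
          rw [this]; positivity

open Finset Filter Topology in
theorem ZMod.tendsto_sum_div_LFunction_one {N : ℕ} [NeZero N] {Φ : ZMod N → ℂ}
    (hΦ : ∑ a, Φ a = 0) :
    Tendsto (fun n ↦ ∑ i ∈ range n, Φ (i : ZMod N) / (i : ℂ)) atTop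
      (𝓝 (ZMod.LFunction Φ 1)) := by
  obtain ⟨B, hB⟩ := ZMod.exists_norm_sum_range_le hΦ
  set c : ℕ → ℂ := fun i ↦ Φ ((i + 1 : ℕ) : ZMod N) with hc
  let u : ℝ → ℕ → ℝ := fun s i ↦ ((i : ℝ) + 1) ^ (-s)
  let f : ℝ → ℕ → ℂ := fun s i ↦ (∑ j ∈ range (i + 1), c j) * ((u s i - u s (i + 1) : ℝ) : ℂ)
  have hu0 : ∀ s, 1 ≤ s → Tendsto (u s) atTop (𝓝 0) := fun s hs ↦
    (tendsto_rpow_neg_atTop (by linarith)).comp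
      (tendsto_atTop_add_const_right _ 1 tendsto_natCast_atTop_atTop)
  have hbd_sum : Summable fun i : ℕ ↦ B * (2 * (1 / ((i : ℝ) + 1) ^ 2)) := by
    have := (summable_nat_add_iff 1).mpr (Real.summable_one_div_nat_pow.mpr one_lt_two)
    simpa using (this.mul_left 2).mul_left B
  have hbd : ∀ s ∈ Set.Icc (1 : ℝ) 2, ∀ i, ‖f s i‖ ≤ B * (2 * (1 / ((i : ℝ) + 1) ^ 2)) := by
    intro s hs i
    have h := rpow_neg_sub_rpow_neg_mem_Icc (x := (i : ℝ) + 1) (by simp) hs.1 hs.2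
    simp only [f, norm_mul, Complex.norm_real, u]
    push_cast
    rw [Real.norm_of_nonneg h.1]
    exact mul_le_mul (hB _) h.2 h.1 ((norm_nonneg _).trans (hB 0))
  have hsum : ∀ s ∈ Set.Icc (1 : ℝ) 2, Summable (f s) := fun s hs ↦
    hbd_sum.of_norm_bounded (hbd s hs)
  have hlim : ∀ s ∈ Set.Icc (1 : ℝ) 2,
      Tendsto (fun n ↦ ∑ i ∈ range n, c i * (u s i : ℂ)) atTop (𝓝 (∑' i, f s i)) := fun s hs ↦
    tendsto_sum_mul_of_bounded_partial_sums hB (hu0 s hs.1) (hsum s hs)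
  have hev : ∀ᶠ s : ℝ in 𝓝[>] 1, s ∈ Set.Ioc (1 : ℝ) 2 := Ioc_mem_nhdsGT one_lt_two
  have hcont : Tendsto (fun s ↦ ∑' i, f s i) (𝓝[>] 1) (𝓝 (∑' i, f 1 i)) := by
    refine tendsto_tsum_of_dominated_convergence hbd_sum (fun i ↦ ?_)
      (hev.mono fun s hs i ↦ hbd s ⟨hs.1.le, hs.2⟩ i)
    refine tendsto_nhdsWithin_of_tendsto_nhds (Continuous.tendsto ?_ 1)
    have hp : ∀ i : ℕ, Continuous fun s : ℝ ↦ u s i := fun i ↦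
      Real.continuous_const_rpow (by positivity) |>.comp continuous_neg
    exact continuous_const.mul (Complex.continuous_ofReal.comp ((hp i).sub (hp (i + 1))))
  have heq : ∀ s ∈ Set.Ioc (1 : ℝ) 2, ∑' i, f s i = ZMod.LFunction Φ s := by
    intro s hs
    have hs' : 1 < (s : ℂ).re := by simpa using hs.1
    rw [ZMod.LFunction_eq_LSeries Φ hs']
    have hL := (ZMod.LSeriesSummable_of_one_lt_re Φ hs').hasSum
    have h1 := ((hasSum_nat_add_iff' 1).mpr hL).tendsto_sum_nat
    refine tendsto_nhds_unique (hlim s ⟨hs.1.le, hs.2⟩) ?_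
    convert h1 using 2 with n
    · refine sum_congr rfl fun i _ ↦ ?_
      rw [LSeries.term_of_ne_zero (by simp)]
      simp only [hc, u]
      rw [Complex.ofReal_cpow (by positivity), Complex.ofReal_neg, Complex.cpow_neg, div_eq_mul_inv]
      push_cast
      rfl
    · simp [LSeries]
  have hL1 : Tendsto (fun s : ℝ ↦ ZMod.LFunction Φ s) (𝓝[>] 1) (𝓝 (ZMod.LFunction Φ 1)) := by
    refine tendsto_nhdsWithin_of_tendsto_nhds ?_
    have := ((ZMod.differentiable_LFunction_of_sum_zero hΦ).continuous.comp
      Complex.continuous_ofReal).tendsto 1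
    simpa [Function.comp_def] using this
  have hval : ∑' i, f 1 i = ZMod.LFunction Φ 1 :=
    tendsto_nhds_unique (hcont.congr' (hev.mono heq)) hL1
  rw [← tendsto_add_atTop_iff_nat 1, ← hval]
  refine (hlim 1 ⟨le_rfl, one_le_two⟩).congr fun n ↦ ?_
  rw [sum_range_succ']
  simp [hc, u, Real.rpow_neg_one, div_eq_mul_inv]

open Filter Topology in
theorem ZMod.tendsto_tsum_div_mul_pow_LFunction_one {N : ℕ} [NeZero N] {Φ : ZMod N → ℂ}
    (hΦ : ∑ a, Φ a = 0) :
    Tendsto (fun x : ℝ ↦ ∑' n : ℕ, Φ (n : ZMod N) / (n : ℂ) * (x : ℂ) ^ n) (𝓝[<] 1)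
      (𝓝 (ZMod.LFunction Φ 1)) :=
  tendsto_map'_iff.mp
    (Complex.tendsto_tsum_powerSeries_nhdsWithin_lt (ZMod.tendsto_sum_div_LFunction_one hΦ))

open Filter Topology ComplexConjugate in
theorem ZMod.LFunction_dft_one_of_even {N : ℕ} [NeZero N] {Ψ : ZMod N → ℂ} (h0 : Ψ 0 = 0)
    (hΨ : Ψ.Even) :
    ZMod.LFunction (ZMod.dft Ψ) 1 =
      -∑ j, Ψ j * (Real.log ‖1 - ZMod.stdAddChar j‖ : ℂ) := by
  set e : ZMod N → ℂ := fun j ↦ ZMod.stdAddChar j with he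
  have hnorm : ∀ j, ‖e j‖ = 1 := fun j ↦ by simp [he]
  have hslit : ∀ j, j ≠ 0 → 1 - e j ∈ Complex.slitPlane := by
    intro j hj
    have hne : e j ≠ 1 := fun h ↦
      hj (ZMod.injective_stdAddChar (h.trans (AddChar.map_zero_eq_one _).symm))
    left
    have h1 : (e j).re ≤ 1 := (Complex.re_le_norm _).trans (hnorm j).le
    have h2 : (e j).re ≠ 1 := by
      intro h
      apply hne
      have h3 := Complex.sq_norm (e j)
      rw [hnorm, Complex.normSq_apply, h] at h3
      have : (e j).im = 0 := by nlinarith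
      exact Complex.ext (by simpa using h) (by simpa using this)
    have := lt_of_le_of_ne h1 h2
    simpa using this
  have hsum : ∑ a, ZMod.dft Ψ a = 0 := by
    rw [← ZMod.dft_apply_zero, ZMod.dft_dft]
    simp [h0]
  have hpow : ∀ x ∈ Set.Ioo (0 : ℝ) 1,
      ∑' n : ℕ, ZMod.dft Ψ (n : ZMod N) / (n : ℂ) * (x : ℂ) ^ n =
        ∑ j, Ψ j * -Complex.log (1 - e (-j) * x) := by
    intro x hx
    have h : HasSum (fun n : ℕ ↦ ∑ j, Ψ j * ((e (-j) * x) ^ n / n))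
        (∑ j, Ψ j * -Complex.log (1 - e (-j) * x)) :=
      hasSum_sum fun j _ ↦ (Complex.hasSum_taylorSeries_neg_log (by
        rw [norm_mul, hnorm, one_mul, Complex.norm_real, Real.norm_of_nonneg hx.1.le]
        exact hx.2)).mul_left _
    rw [← h.tsum_eq]
    refine tsum_congr fun n ↦ ?_
    rw [ZMod.dft_apply, Finset.sum_div, Finset.sum_mul]
    refine Finset.sum_congr rfl fun j _ ↦ ?_
    have : ZMod.stdAddChar (-(j * (n : ZMod N))) = e (-j) ^ n := by
      rw [he, ← AddChar.map_nsmul_eq_pow, nsmul_eq_mul]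
      ring_nf
    rw [this, smul_eq_mul, mul_pow]
    ring
  have hlim : Tendsto (fun x : ℝ ↦ ∑ j, Ψ j * -Complex.log (1 - e (-j) * x)) (𝓝[<] 1)
      (𝓝 (∑ j, Ψ j * -Complex.log (1 - e (-j)))) := by
    refine tendsto_finsetSum _ fun j _ ↦ ?_
    by_cases hj : j = 0
    · simp [hj, h0]
    refine (tendsto_nhdsWithin_of_tendsto_nhds ?_).neg.const_mul _
    have hc : ContinuousAt (fun x : ℝ ↦ Complex.log (1 - e (-j) * x)) 1 := by
      refine ContinuousAt.clog (by fun_prop) ?_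
      simpa using hslit (-j) (neg_ne_zero.mpr hj)
    simpa [ContinuousAt] using hc
  have hev : ∀ᶠ x : ℝ in 𝓝[<] 1, x ∈ Set.Ioo (0 : ℝ) 1 := Ioo_mem_nhdsLT one_pos
  rw [tendsto_nhds_unique (ZMod.tendsto_tsum_div_mul_pow_LFunction_one hsum)
    (hlim.congr' (hev.mono fun x hx ↦ (hpow x hx).symm))]
  have hrefl : ∑ j, Ψ j * -Complex.log (1 - e (-j)) = ∑ j, Ψ j * -Complex.log (1 - e j) := by
    rw [← Equiv.sum_comp (Equiv.neg (ZMod N))]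
    simp [hΨ _]
  have hdouble : ∀ j, Ψ j * -Complex.log (1 - e (-j)) + Ψ j * -Complex.log (1 - e j) =
      2 * -(Ψ j * (Real.log ‖1 - e j‖ : ℂ)) := by
    intro j
    by_cases hj : j = 0
    · simp [hj, h0]
    have hconj : 1 - e (-j) = conj (1 - e j) := by
      simp [he, AddChar.map_neg_eq_conj]
    rw [hconj, Complex.log_conj _ (Complex.slitPlane_arg_ne_pi (hslit j hj)), ← Complex.log_re]
    have hadd := Complex.add_conj (Complex.log (1 - e j))
    push_cast at hadd
    linear_combination (-Ψ j) * hadd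
  have := Finset.sum_congr (rfl : (Finset.univ : Finset (ZMod N)) = _) fun j _ ↦ hdouble j
  rw [Finset.sum_add_distrib, ← hrefl, ← two_mul, ← Finset.mul_sum, Finset.sum_neg_distrib] at this
  exact mul_left_cancel₀ two_ne_zero this

theorem DirichletCharacter.IsPrimitive.sum_mul_log_norm_ne_zero {N : ℕ} [NeZero N]
    {χ : DirichletCharacter ℂ N} (hχ : χ.IsPrimitive) (hN : N ≠ 1) (heven : χ.Even) :
    ∑ j, χ j * (Real.log ‖1 - ZMod.stdAddChar j‖ : ℂ) ≠ 0 := by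
  intro hT
  have hne : χ ≠ 1 := by
    rw [Ne, DirichletCharacter.eq_one_iff_conductor_eq_one, hχ]
    exact hN
  have hL := ZMod.LFunction_dft_one_of_even (χ.map_zero' hN) heven.to_fun
  have hF : ZMod.dft χ = fun j ↦ gaussSum χ ZMod.stdAddChar * χ⁻¹ j := by
    ext j
    have hinv : (χ⁻¹).Even := by
      rw [DirichletCharacter.Even, MulChar.inv_apply_eq_inv, heven, Ring.inverse_one]
    rw [hχ.fourierTransform_eq_inv_mul_gaussSum, hinv.eval_neg, mul_comm]
  rw [hT, neg_zero, hF] at hL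
  have hmul : gaussSum χ ZMod.stdAddChar * DirichletCharacter.LFunction χ⁻¹ 1 = 0 := by
    rw [← hL, DirichletCharacter.LFunction, ZMod.LFunction, ZMod.LFunction, Finset.mul_sum,
      Finset.mul_sum, Finset.mul_sum]
    exact Finset.sum_congr rfl fun j _ ↦ by ring
  rcases mul_eq_zero.mp hmul with h | h
  · have : ZMod.dft (χ : ZMod N → ℂ) = 0 := by
      rw [hF, h]
      ext
      simp
    have h1 := congrFun ((LinearEquiv.map_eq_zero_iff _).mp this) 1
    simp at h1
  · exact DirichletCharacter.LFunction_apply_one_ne_zero (inv_ne_one.mpr hne) h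

theorem DirichletCharacter.mul_sum_mul_comp_mul_left {N : ℕ} [NeZero N]
    (χ : DirichletCharacter ℂ N) {c : ZMod N} (hc : IsUnit c) (f : ZMod N → ℂ) :
    χ c * ∑ b, χ b * f (c * b) = ∑ b, χ b * f b := by
  obtain ⟨u, rfl⟩ := hc
  rw [Finset.mul_sum, ← Equiv.sum_comp (Units.mulLeft u) (fun b ↦ χ b * f b)]
  refine Finset.sum_congr rfl fun b _ ↦ ?_
  simp [mul_assoc]

theorem DirichletCharacter.exists_even_apply_eq_one_apply_ne_one {m : ℕ} [NeZero m]
    {u v : (ZMod m)ˣ} (h : u ∉ Subgroup.zpowers v ⊔ Subgroup.zpowers (-1)) :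
    ∃ χ : DirichletCharacter ℂ m, χ.Even ∧ χ v = 1 ∧ χ u ≠ 1 := by
  set H : Subgroup (ZMod m)ˣ := Subgroup.zpowers v ⊔ Subgroup.zpowers (-1) with hH
  have hu : (u : (ZMod m)ˣ ⧸ H) ≠ 1 := by rwa [Ne, QuotientGroup.eq_one_iff]
  have : NeZero (Monoid.exponent ((ZMod m)ˣ ⧸ H)) := 
    ⟨ne_zero_of_dvd_ne_zero Nat.card_pos.ne' Group.exponent_dvd_nat_card⟩
  obtain ⟨φ, hφ⟩ := CommGroup.exists_apply_ne_one_of_hasEnoughRootsOfUnity ((ZMod m)ˣ ⧸ H) ℂ hu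
  let χ : DirichletCharacter ℂ m := MulChar.ofUnitHom (φ.comp (QuotientGroup.mk' H))
  have hχ : ∀ w : (ZMod m)ˣ, χ w = φ (w : (ZMod m)ˣ ⧸ H) := fun w ↦
    MulChar.ofUnitHom_coe _ w
  have hχH : ∀ w ∈ H, χ w = 1 := fun w hw ↦ by
    rw [hχ, (QuotientGroup.eq_one_iff w).mpr hw, map_one, Units.val_one]
  refine ⟨χ, ?_, hχH v (hH ▸ Subgroup.mem_sup_left (Subgroup.mem_zpowers v)), ?_⟩
  · simpa [DirichletCharacter.Even] using hχH (-1) (hH ▸ Subgroup.mem_sup_right (Subgroup.mem_zpowers _))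
  · rw [hχ]
    exact fun h1 ↦ hφ (Units.ext h1)

theorem mem_sup_zpowers_neg_one_of_prod_root_sub_one_eq {a r k m : ℕ} [NeZero m] (hk : 0 < k)
    (ham : a.Coprime m) (hrm : r.Coprime m)
    (h : ∀ ζ : ℂ, ζ ^ m = 1 → ζ ≠ 1 → ∏ i ∈ Finset.range k, (ζ ^ (a * r ^ i) - 1) =
      ∏ i ∈ Finset.range k, (ζ ^ (r ^ i) - 1)) :
    ZMod.unitOfCoprime a ham ∈
      Subgroup.zpowers (ZMod.unitOfCoprime r hrm) ⊔ Subgroup.zpowers (-1) := by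
  by_contra hmem
  obtain ⟨χ, heven, hχr, hχa⟩ := DirichletCharacter.exists_even_apply_eq_one_apply_ne_one hmem
  rw [ZMod.coe_unitOfCoprime] at hχr hχa
  have hχ1 : χ ≠ 1 := by
    rintro rfl
    exact hχa (MulChar.one_apply ((ZMod.isUnit_iff_coprime a m).mpr ham))
  set N := χ.conductor with hN
  set ψ : DirichletCharacter ℂ N := χ.primitiveCharacter with hψ
  have hNm : N ∣ m := χ.conductor_dvd_level
  have : NeZero N := ⟨χ.conductor_ne_zero⟩
  have hN1 : N ≠ 1 := fun h1 ↦ hχ1 (DirichletCharacter.eq_one_iff_conductor_eq_one.mpr h1)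
  have hψχ : ∀ n : ℕ, n.Coprime m → ψ (n : ZMod N) = χ n := fun n hn ↦ by
    have := χ.primitiveCharacter_apply_of_isCoprime (a := (n : ℤ)) (Nat.isCoprime_iff_coprime.mpr hn)
    simpa using this
  have hψeven : ψ.Even := by
    have := χ.primitiveCharacter_apply_of_isCoprime (a := -1) isCoprime_one_left.neg_left
    simp only [Int.cast_neg, Int.cast_one] at this
    exact this.trans heven
  have hunit : ∀ n : ℕ, n.Coprime m → IsUnit (n : ZMod N) := fun n hn ↦
    (ZMod.isUnit_iff_coprime n N).mpr (hn.coprime_dvd_right hNm)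
  let L : ZMod N → ℂ := fun j ↦ (Real.log ‖1 - ZMod.stdAddChar j‖ : ℂ)
  have hT : ∑ j, ψ j * L j ≠ 0 :=
    χ.primitiveCharacter_isPrimitive.sum_mul_log_norm_ne_zero hN1 hψeven
  have hLprod : ∀ (b : ZMod N) (e : ℕ → ℕ), b ≠ 0 → (∀ i, (e i).Coprime m) →
      ∑ i ∈ Finset.range k, L ((e i : ZMod N) * b) =
        (Real.log ‖∏ i ∈ Finset.range k, ((ZMod.stdAddChar b : ℂ) ^ (e i) - 1)‖ : ℂ) := by
    intro b e hb he
    have hpow : ∀ i, (ZMod.stdAddChar b : ℂ) ^ (e i) = ZMod.stdAddChar ((e i : ZMod N) * b) :=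
      fun i ↦ by rw [← AddChar.map_nsmul_eq_pow, nsmul_eq_mul]
    rw [norm_prod, Real.log_prod, Complex.ofReal_sum]
    · refine Finset.sum_congr rfl fun i _ ↦ ?_
      rw [hpow, norm_sub_rev]
    · intro i _
      rw [norm_ne_zero_iff, hpow, sub_ne_zero]
      intro h1
      have h2 := ZMod.injective_stdAddChar (h1.trans (AddChar.map_zero_eq_one _).symm)
      exact hb (((hunit _ (he i)).mul_right_eq_zero).mp h2)
  have hsum : ∀ b : ZMod N, ∑ i ∈ Finset.range k, L (((a * r ^ i : ℕ) : ZMod N) * b) =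
      ∑ i ∈ Finset.range k, L (((r ^ i : ℕ) : ZMod N) * b) := by
    intro b
    by_cases hb : b = 0
    · simp [hb]
    rw [hLprod b _ hb fun i ↦ ham.mul_left (hrm.pow_left i), hLprod b _ hb fun i ↦ hrm.pow_left i,
      h]
    · rw [← AddChar.map_nsmul_eq_pow, nsmul_eq_mul, (ZMod.natCast_eq_zero_iff m N).mpr hNm,
        zero_mul, AddChar.map_zero_eq_one]
    · exact fun h1 ↦ hb (ZMod.injective_stdAddChar (h1.trans (AddChar.map_zero_eq_one _).symm))
  have hψr : ∀ i, ψ ((r ^ i : ℕ) : ZMod N) = 1 := fun i ↦ by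
    rw [Nat.cast_pow, map_pow, hψχ r hrm, hχr, one_pow]
  have hR : ∑ b, ψ b * ∑ i ∈ Finset.range k, L (((r ^ i : ℕ) : ZMod N) * b) =
      k * ∑ j, ψ j * L j := by
    simp_rw [Finset.mul_sum]
    rw [Finset.sum_comm, ← Finset.mul_sum, ← nsmul_eq_mul]
    conv_rhs => rw [← Finset.card_range k]
    refine Finset.sum_eq_card_nsmul fun i _ ↦ ?_
    rw [← ψ.mul_sum_mul_comp_mul_left (hunit _ (hrm.pow_left i)) L, hψr, one_mul]
  have hA : χ a * ∑ b, ψ b * ∑ i ∈ Finset.range k, L (((a * r ^ i : ℕ) : ZMod N) * b) =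
      k * ∑ j, ψ j * L j := by
    simp_rw [Finset.mul_sum]
    rw [Finset.sum_comm, ← Finset.mul_sum, ← nsmul_eq_mul]
    conv_rhs => rw [← Finset.card_range k]
    refine Finset.sum_eq_card_nsmul fun i _ ↦ ?_
    rw [← ψ.mul_sum_mul_comp_mul_left (hunit _ (ham.mul_left (hrm.pow_left i))) L,
      Nat.cast_mul a, map_mul, hψr, mul_one, hψχ a ham, Finset.mul_sum]
  rw [Finset.sum_congr rfl fun b _ ↦ by rw [hsum b], hR] at hA
  have hkT : (k : ℂ) * ∑ j, ψ j * L j ≠ 0 := mul_ne_zero (by exact_mod_cast hk.ne') hT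
  exact hχa (mul_right_cancel₀ hkT (hA.trans (one_mul _).symm))

theorem pow_eq_pow_of_natCast_zmod_eq {R : Type*} [CommMonoid R] {m : ℕ} {x : R} (hx : x ^ m = 1)
    {n n' : ℕ} (h : (n : ZMod m) = n') : x ^ n = x ^ n' :=
  pow_eq_pow_of_modEq ((ZMod.natCast_eq_natCast_iff _ _ _).mp h) hx

theorem Finset.prod_range_add_of_apply_eq {M : Type*} [CommMonoid M] {h : ℕ → M} {k : ℕ}
    (hper : ∀ i, h (i + k) = h i) (j : ℕ) :
    ∏ i ∈ range k, h (i + j) = ∏ i ∈ range k, h i := by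
  induction j with
  | zero => rfl
  | succ j ih =>
    rw [← ih]
    cases k with
    | zero => rfl
    | succ k =>
      rw [prod_range_succ, prod_range_succ' (fun i ↦ h (i + j))]
      congr 1
      · exact prod_congr rfl fun i _ ↦ by ring_nf
      · rw [← hper (0 + j)]
        ring_nf

theorem prod_pow_mul_pow_sub_one_eq {R : Type*} [CommRing R] {a r k m j : ℕ} {x : R}
    (hx : x ^ m = 1) (hrk : (r : ZMod m) ^ k = 1) (ha : (a : ZMod m) = (r : ZMod m) ^ j) :
    ∏ i ∈ Finset.range k, (x ^ (a * r ^ i) - 1) = ∏ i ∈ Finset.range k, (x ^ (r ^ i) - 1) := by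
  rw [← Finset.prod_range_add_of_apply_eq (h := fun i ↦ x ^ (r ^ i) - 1) (k := k) _ j]
  · refine Finset.prod_congr rfl fun i _ ↦ ?_
    rw [pow_eq_pow_of_natCast_zmod_eq hx (n' := r ^ (i + j))]
    push_cast
    rw [ha]
    ring
  · intro i
    rw [pow_eq_pow_of_natCast_zmod_eq hx (n' := r ^ i)]
    push_cast
    rw [pow_add, hrk, mul_one]

theorem prod_pow_mul_pow_sub_one_eq_of_neg {R : Type*} [CommRing R] {a r k m j : ℕ} {x : R}
    (hx : x ^ m = 1) (hrk : (r : ZMod m) ^ k = 1) (ha : -(a : ZMod m) = (r : ZMod m) ^ j) :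
    ∏ i ∈ Finset.range k, (x ^ (a * r ^ i) - 1) =
      (-1) ^ k * x ^ (a * ∑ i ∈ Finset.range k, r ^ i) *
        ∏ i ∈ Finset.range k, (x ^ (r ^ i) - 1) := by
  have hterm : ∀ i, x ^ (a * r ^ i) - 1 = -x ^ (a * r ^ i) * (x ^ (r ^ j * r ^ i) - 1) := by
    intro i
    have : x ^ (a * r ^ i) * x ^ (r ^ j * r ^ i) = 1 := by
      rw [← pow_add, ← pow_zero x]
      apply pow_eq_pow_of_natCast_zmod_eq hx
      push_cast
      rw [← ha]
      ring
    linear_combination this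
  rw [Finset.prod_congr rfl fun i _ ↦ hterm i, Finset.prod_mul_distrib, Finset.prod_neg,
    Finset.card_range, Finset.prod_pow_eq_pow_sum, ← Finset.mul_sum,
    prod_pow_mul_pow_sub_one_eq hx hrk (by push_cast; rfl)]

theorem geom_sum_X_dvd_sub_of_forall {m : ℕ} {p q : ℤ[X]}
    (h : ∀ x : AdjoinRoot (X ^ m - 1 : ℤ[X]), x ^ m = 1 → aeval x p = aeval x q) :
    (∑ i ∈ Finset.range m, (X : ℤ[X]) ^ i) ∣ p - q := by
  have hroot : AdjoinRoot.root (X ^ m - 1 : ℤ[X]) ^ m = 1 := by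
    have := AdjoinRoot.mk_self (f := (X ^ m - 1 : ℤ[X]))
    rwa [map_sub, map_pow, AdjoinRoot.mk_X, map_one, sub_eq_zero] at this
  have := h _ hroot
  rw [AdjoinRoot.aeval_eq, AdjoinRoot.aeval_eq, ← sub_eq_zero, ← map_sub,
    AdjoinRoot.mk_eq_zero] at this
  exact (Dvd.intro _ (geom_sum_mul (X : ℤ[X]) m)).trans this

theorem aeval_eq_of_geom_sum_X_dvd_sub {m : ℕ} {p q : ℤ[X]}
    (h : (∑ i ∈ Finset.range m, (X : ℤ[X]) ^ i) ∣ p - q) {ζ : ℂ} (hζ : ζ ^ m = 1) (hζ1 : ζ ≠ 1) :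
    aeval ζ p = aeval ζ q := by
  obtain ⟨c, hc⟩ := h
  have hgeom : ∑ i ∈ Finset.range m, ζ ^ i = 0 := by
    have := geom_sum_mul ζ m
    rw [hζ, sub_self] at this
    exact (mul_eq_zero.mp this).resolve_right (sub_ne_zero.mpr hζ1)
  have := congrArg (aeval ζ) hc
  simpa [hgeom, sub_eq_zero] using this

theorem exists_eq_pow_or_neg_eq_pow_of_mem_sup {m : ℕ} [NeZero m] {u v : (ZMod m)ˣ}
    (h : u ∈ Subgroup.zpowers v ⊔ Subgroup.zpowers (-1)) :
    ∃ i : ℕ, u = v ^ i ∨ -u = v ^ i := by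
  obtain ⟨y, hy, z, hz, rfl⟩ := Subgroup.mem_sup.mp h
  obtain ⟨i, rfl⟩ := mem_powers_iff_mem_zpowers.mpr hy
  obtain ⟨j, rfl⟩ := mem_powers_iff_mem_zpowers.mpr hz
  refine ⟨i, ?_⟩
  rcases neg_one_pow_eq_or (ZMod m)ˣ j with hj | hj
  · left; simp [hj]
  · right; simp [hj]

theorem even_and_dvd_sum_of_neg_eq_pow {a r k m j : ℕ} (hm : 2 < m)
    (ham : a.Coprime m) (hrm : r.Coprime m) (hrk : (r : ZMod m) ^ k = 1)
    (h : ∀ ζ : ℂ, ζ ^ m = 1 → ζ ≠ 1 → ∏ i ∈ Finset.range k, (ζ ^ (a * r ^ i) - 1) =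
      ∏ i ∈ Finset.range k, (ζ ^ (r ^ i) - 1))
    (ha : -(a : ZMod m) = (r : ZMod m) ^ j) :
    Even k ∧ m ∣ ∑ i ∈ Finset.range k, r ^ i := by
  set S := ∑ i ∈ Finset.range k, r ^ i with hS
  have key : ∀ ζ : ℂ, ζ ^ m = 1 → ζ ≠ 1 → (-1) ^ k * ζ ^ (a * S) = 1 := by
    intro ζ hζ hζ1
    have hne : ∏ i ∈ Finset.range k, (ζ ^ (r ^ i) - 1) ≠ 0 := by
      refine Finset.prod_ne_zero_iff.mpr fun i _ ↦ sub_ne_zero.mpr fun h1 ↦ hζ1 ?_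
      exact by
        have := pow_gcd_eq_one.mpr ⟨h1, hζ⟩
        rwa [(hrm.pow_left i).gcd_eq_one, pow_one] at this
    have := h ζ hζ hζ1
    rw [prod_pow_mul_pow_sub_one_eq_of_neg hζ hrk ha] at this
    exact mul_right_cancel₀ hne (this.trans (one_mul _).symm)
  have hprim := Complex.isPrimitiveRoot_exp m (by omega)
  set ζ := Complex.exp (2 * Real.pi * Complex.I / m)
  have h1 := key ζ hprim.pow_eq_one (hprim.ne_one (by omega))
  rcases Nat.even_or_odd k with hk | hk
  · refine ⟨hk, ?_⟩
    rw [hk.neg_one_pow, one_mul] at h1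
    exact ham.symm.dvd_of_dvd_mul_left ((hprim.pow_eq_one_iff_dvd _).mp h1)
  · have h2 := key (ζ ^ 2) (by rw [pow_right_comm, hprim.pow_eq_one, one_pow])
      (hprim.pow_ne_one_of_pos_of_lt two_ne_zero hm)
    rw [hk.neg_one_pow] at h1 h2
    rw [pow_right_comm] at h2
    have h3 : ζ ^ (a * S) = -1 := by linear_combination -h1
    rw [h3] at h2
    norm_num at h2

theorem stmt_14 (a r k m : ℕ) (ha : 0 < a) (hr : 0 < r) (hk : 0 < k) (hm : 0 < m)
    (ham : Nat.Coprime a m) (hrm : Nat.Coprime r m)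
    (hak : a ^ k ≡ 1 [MOD m]) (hrk : r ^ k ≡ 1 [MOD m])
    (hr1 : ¬ r ≡ 1 [MOD m]) :
    (∑ i ∈ Finset.range m, (X : ℤ[X]) ^ i) ∣
        (∏ i ∈ Finset.range k, ((X : ℤ[X]) ^ (a * r ^ i) - 1)
          - ∏ i ∈ Finset.range k, ((X : ℤ[X]) ^ (r ^ i) - 1)) ↔
      ((∃ i : ℕ, (a : ZMod m) = (r : ZMod m) ^ i) ∨
        ((∃ i : ℕ, -(a : ZMod m) = (r : ZMod m) ^ i) ∧ Even k ∧
          m ∣ ∑ i ∈ Finset.range k, r ^ i)) := by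
  have : NeZero m := ⟨hm.ne'⟩
  have hrk' : (r : ZMod m) ^ k = 1 := by
    exact_mod_cast (ZMod.natCast_eq_natCast_iff _ _ _).mpr hrk
  have hm2 : 2 < m := by
    by_contra! hle
    apply hr1
    interval_cases m
    · exact Nat.modEq_one
    · exact Nat.odd_iff.mp (Nat.coprime_two_right.mp hrm)
  constructor
  · intro hdvd
    have h : ∀ ζ : ℂ, ζ ^ m = 1 → ζ ≠ 1 → ∏ i ∈ Finset.range k, (ζ ^ (a * r ^ i) - 1) =
        ∏ i ∈ Finset.range k, (ζ ^ (r ^ i) - 1) := fun ζ hζ hζ1 ↦ by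
      simpa [map_prod] using aeval_eq_of_geom_sum_X_dvd_sub hdvd hζ hζ1
    obtain ⟨i, hi | hi⟩ := exists_eq_pow_or_neg_eq_pow_of_mem_sup
      (mem_sup_zpowers_neg_one_of_prod_root_sub_one_eq hk ham hrm h)
    · exact .inl ⟨i, by simpa using congrArg Units.val hi⟩
    · have hi' : -(a : ZMod m) = (r : ZMod m) ^ i := by simpa using congrArg Units.val hi
      exact .inr ⟨⟨i, hi'⟩, even_and_dvd_sum_of_neg_eq_pow hm2 ham hrm hrk' h hi'⟩
  · rintro (⟨j, hj⟩ | ⟨⟨j, hj⟩, hkeven, hS⟩)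
    · refine geom_sum_X_dvd_sub_of_forall fun x hx ↦ ?_
      simpa [map_prod] using prod_pow_mul_pow_sub_one_eq hx hrk' hj
    · refine geom_sum_X_dvd_sub_of_forall fun x hx ↦ ?_
      have hxS : x ^ (a * ∑ i ∈ Finset.range k, r ^ i) = 1 :=
        orderOf_dvd_iff_pow_eq_one.mp ((orderOf_dvd_of_pow_eq_one hx).trans (hS.mul_left a))
      simpa [map_prod, hkeven.neg_one_pow, hxS] using
        prod_pow_mul_pow_sub_one_eq_of_neg hx hrk' hj
end

section
/- Let a, b, k, m be positive integers with a, b ≥ 2 and gcd(a,b) = 1, and let S = ⟨Geom(a,b;k)⟩. Suppose gcd(ab, m) = 1, let u, v ∈ (ℤ/mℤ)× be the images of a and b, let r = u^{-1}·v, and let R be the subgroup of (ℤ/mℤ)× generated by r. Then the gap set H(S) is equidistributed modulo m if and only if at least one of the following seven conditions holds: (1) u = 1 or v = 1; (2) u = v = −1, k is even, and m divides k; (3) u = v = −1, k is odd, and m divides k + 1; (4) u ≠ v, u^k = v^k = 1, and u ∈ R; (5) u ≠ v, u^k = v^k = 1, −u ∈ R, k is even, and 1 + r + r² + ⋯ +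 r^{k−1} = 0 in ℤ/mℤ; (6) u ≠ v, u^{k+1} = v^{k+1} = 1, and u ∈ R; (7) u ≠ v, u^{k+1} = v^{k+1} = 1, −u ∈ R, k is odd, and 1 + r + r² + ⋯ + r^{k} = 0 in ℤ/mℤ. -/
/-- The numerical semigroup generated by the geometric sequence
`a^k, a^(k-1)*b, …, b^k`. -/
def geomNS (a b k : ℕ) : AddSubmonoid ℕ :=
  AddSubmonoid.closure ((fun i => a ^ (k - i) * b ^ i) '' Set.Iic k)

/-- A set of naturals is equidistributed modulo `m`: every residue class modulo `m`
contains the same number of elements of the set. -/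
def EquidistMod (T : Set ℕ) (m : ℕ) : Prop :=
  ∀ r s : ZMod m,
    Nat.card {n : ℕ // n ∈ T ∧ (n : ZMod m) = r} =
      Nat.card {n : ℕ // n ∈ T ∧ (n : ZMod m) = s}

section

open Filter Topology

lemma sum_mul_pow_eq_of_summation_by_parts (a : ℕ → ℂ) (z : ℂ) (N : ℕ) :
    ∑ i ∈ Finset.range N, a i * z ^ i =
      a N * ∑ j ∈ Finset.range N, z ^ j +
        ∑ i ∈ Finset.range N, (a i - a (i + 1)) * ∑ j ∈ Finset.range (i + 1), z ^ j := by
  induction N with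
  | zero => simp
  | succ N ih =>
    rw [Finset.sum_range_succ, ih,
      Finset.sum_range_succ (fun i => (a i - a (i + 1)) * ∑ j ∈ Finset.range (i + 1), z ^ j),
      Finset.sum_range_succ (fun j => z ^ j)]
    ring

lemma norm_geom_sum_le {z : ℂ} (hz : ‖z‖ = 1) (hz1 : z ≠ 1) (N : ℕ) :
    ‖∑ j ∈ Finset.range N, z ^ j‖ ≤ 2 / ‖z - 1‖ := by
  rw [geom_sum_eq hz1, norm_div]
  gcongr
  calc ‖z ^ N - 1‖ ≤ ‖z ^ N‖ + ‖(1 : ℂ)‖ := norm_sub_le _ _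
    _ = 2 := by rw [norm_pow, hz]; norm_num

/-- The coefficients `(i + 1) ^ (-s)` of a Dirichlet series. -/
noncomputable def dirichletCoeff (s : ℝ) (i : ℕ) : ℝ := (((i : ℝ) + 1) ^ s)⁻¹

lemma abs_dirichletCoeff_sub_le {s : ℝ} (h1 : 1 ≤ s) (h2 : s ≤ 2) (i : ℕ) :
    |dirichletCoeff s i - dirichletCoeff s (i + 1)| ≤ 2 * (((i : ℝ) + 1) ^ 2)⁻¹ := by
  unfold dirichletCoeff
  push_cast
  have hi : (0 : ℝ) < (i : ℝ) + 1 := by positivity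
  have hi2 : (0 : ℝ) < (i : ℝ) + 1 + 1 := by positivity
  set x : ℝ := ((i : ℝ) + 1) / ((i : ℝ) + 1 + 1) with hx
  have hx0 : 0 < x := by positivity
  have hx1 : x ≤ 1 := by rw [hx, div_le_one hi2]; linarith
  have key : (((i : ℝ) + 1 + 1) ^ s)⁻¹ = (((i : ℝ) + 1) ^ s)⁻¹ * x ^ s := by
    rw [hx, Real.div_rpow hi.le hi2.le]
    field_simp
  have hxs : x ^ (2 : ℝ) ≤ x ^ s := Real.rpow_le_rpow_of_exponent_ge hx0 hx1 h2
  have hxs1 : x ^ s ≤ 1 := Real.rpow_le_one hx0.le hx1 (by linarith)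
  have hA : (((i : ℝ) + 1) ^ s)⁻¹ ≤ ((i : ℝ) + 1)⁻¹ := by
    apply inv_anti₀ hi
    conv_lhs => rw [← Real.rpow_one ((i : ℝ) + 1)]
    exact Real.rpow_le_rpow_of_exponent_le (by linarith [(Nat.cast_nonneg i : (0 : ℝ) ≤ i)]) h1
  rw [key, ← mul_one_sub, abs_of_nonneg (by apply mul_nonneg <;> [positivity; linarith])]
  have hB : 1 - x ^ s ≤ 2 * ((i : ℝ) + 1)⁻¹ := by
    rw [Real.rpow_two] at hxs
    have h3 : 1 - x ^ s ≤ 2 * (1 - x) := by nlinarith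
    have h4 : 1 - x = ((i : ℝ) + 1 + 1)⁻¹ := by rw [hx]; field_simp; ring
    have h5 : ((i : ℝ) + 1 + 1)⁻¹ ≤ ((i : ℝ) + 1)⁻¹ := inv_anti₀ hi (by linarith)
    linarith
  calc (((i : ℝ) + 1) ^ s)⁻¹ * (1 - x ^ s) ≤ ((i : ℝ) + 1)⁻¹ * (2 * ((i : ℝ) + 1)⁻¹) := by
        apply mul_le_mul hA hB (by linarith) (by positivity)
    _ = _ := by rw [pow_two, mul_inv]; ring

lemma tendsto_dirichletCoeff {s : ℝ} (h1 : 1 ≤ s) :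
    Tendsto (dirichletCoeff s) atTop (𝓝 0) := by
  unfold dirichletCoeff
  apply Tendsto.inv_tendsto_atTop
  apply (tendsto_rpow_atTop (by linarith : 0 < s)).comp
  exact tendsto_atTop_add_const_right _ _ tendsto_natCast_atTop_atTop

/-- The Abel-summed version of `∑ z ^ i / (i + 1) ^ s`. -/
noncomputable def abelSum (z : ℂ) (s : ℝ) : ℂ :=
  ∑' i : ℕ, ((dirichletCoeff s i : ℂ) - dirichletCoeff s (i + 1)) *
    ∑ j ∈ Finset.range (i + 1), z ^ j

lemma norm_abelSum_term_le {z : ℂ} (hz : ‖z‖ = 1) (hz1 : z ≠ 1) {s : ℝ} (h1 : 1 ≤ s)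
    (h2 : s ≤ 2) (i : ℕ) :
    ‖((dirichletCoeff s i : ℂ) - dirichletCoeff s (i + 1)) *
      ∑ j ∈ Finset.range (i + 1), z ^ j‖ ≤ 2 * (((i : ℝ) + 1) ^ 2)⁻¹ * (2 / ‖z - 1‖) := by
  rw [norm_mul]
  gcongr
  · rw [← Complex.ofReal_sub, Complex.norm_real]
    exact abs_dirichletCoeff_sub_le h1 h2 i
  · exact norm_geom_sum_le hz hz1 _

lemma summable_abelSum_bound (c : ℝ) :
    Summable fun i : ℕ => 2 * (((i : ℝ) + 1) ^ 2)⁻¹ * c := by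
  apply Summable.mul_right
  apply Summable.mul_left
  have := (summable_nat_add_iff 1).2 (Real.summable_nat_pow_inv.2 one_lt_two)
  simpa using this

lemma tendsto_partialSum_abelSum {z : ℂ} (hz : ‖z‖ = 1) (hz1 : z ≠ 1) {s : ℝ} (h1 : 1 ≤ s)
    (h2 : s ≤ 2) :
    Tendsto (fun N => ∑ i ∈ Finset.range N, (dirichletCoeff s i : ℂ) * z ^ i) atTop
      (𝓝 (abelSum z s)) := by
  simp_rw [sum_mul_pow_eq_of_summation_by_parts]
  rw [← zero_add (abelSum z s)]
  apply Tendsto.add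
  · apply squeeze_zero_norm (a := fun N => ‖(dirichletCoeff s N : ℂ)‖ * (2 / ‖z - 1‖))
    · intro N
      rw [norm_mul]
      gcongr
      exact norm_geom_sum_le hz hz1 _
    · rw [← zero_mul (2 / ‖z - 1‖)]
      apply Tendsto.mul_const
      simpa using (tendsto_dirichletCoeff h1).norm
  · exact (Summable.of_norm_bounded (summable_abelSum_bound _)
      (norm_abelSum_term_le hz hz1 h1 h2)).hasSum.tendsto_sum_nat

lemma tendsto_abelSum {z : ℂ} (hz : ‖z‖ = 1) (hz1 : z ≠ 1) :
    Tendsto (abelSum z) (𝓝[>] 1) (𝓝 (abelSum z 1)) := by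
  unfold abelSum
  apply tendsto_tsum_of_dominated_convergence (summable_abelSum_bound (2 / ‖z - 1‖))
  · intro i
    apply Tendsto.mul_const
    have h : ∀ j, Tendsto (fun s => (dirichletCoeff s j : ℂ)) (𝓝[>] 1)
        (𝓝 (dirichletCoeff 1 j : ℂ)) := by
      intro j
      apply (Complex.continuous_ofReal.tendsto _).comp
      unfold dirichletCoeff
      have hj : (j : ℝ) + 1 ≠ 0 := by positivity
      apply (Tendsto.inv₀ _ (by simpa using hj))
      exact (Real.continuousAt_const_rpow hj).tendsto.mono_left nhdsWithin_le_nhds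
    exact (h i).sub (h (i + 1))
  · filter_upwards [Ioc_mem_nhdsGT (show (1 : ℝ) < 2 by norm_num)] with s hs i
    exact norm_abelSum_term_le hz hz1 hs.1.le hs.2 i

lemma one_sub_mem_slitPlane {z : ℂ} (hz : ‖z‖ = 1) (hz1 : z ≠ 1) : 1 - z ∈ Complex.slitPlane := by
  left
  have h := Complex.re_le_norm z
  rw [hz] at h
  rcases h.lt_or_eq with h | h
  · simpa using h
  · exfalso
    apply hz1
    have h2 := Complex.sq_norm z
    rw [hz, Complex.normSq_apply, h] at h2
    apply Complex.ext <;> simp [h]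
    nlinarith

lemma mul_abelSum_one {z : ℂ} (hz : ‖z‖ = 1) (hz1 : z ≠ 1) :
    z * abelSum z 1 = -Complex.log (1 - z) := by
  have hsum : Tendsto (fun N => ∑ i ∈ Finset.range N, z ^ i / (i : ℂ)) atTop
      (𝓝 (z * abelSum z 1)) := by
    rw [← tendsto_add_atTop_iff_nat 1]
    have := (tendsto_partialSum_abelSum hz hz1 le_rfl one_le_two).const_mul z
    refine this.congr fun N => ?_
    rw [Finset.sum_range_succ', Finset.mul_sum]
    simp only [dirichletCoeff, Real.rpow_one]
    push_cast
    simp only [div_zero, add_zero]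
    refine Finset.sum_congr rfl fun i _ => ?_
    rw [pow_succ]; ring
  have habel := Complex.tendsto_tsum_powerSeries_nhdsWithin_lt hsum
  rw [tendsto_map'_iff] at habel
  have hlog : Tendsto (fun t : ℝ => -Complex.log (1 - z * t)) (𝓝[<] 1)
      (𝓝 (-Complex.log (1 - z))) := by
    have hc : ContinuousAt (fun t : ℝ => -Complex.log (1 - z * t)) 1 := by
      apply ContinuousAt.neg
      apply ContinuousAt.clog
      · fun_prop
      · simpa using one_sub_mem_slitPlane hz hz1
    have := hc.tendsto.mono_left (nhdsWithin_le_nhds (s := Set.Iio 1))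
    simpa using this
  refine tendsto_nhds_unique (habel.congr' ?_) hlog
  filter_upwards [Ioo_mem_nhdsLT (show (0 : ℝ) < 1 by norm_num)] with t ht
  have hnorm : ‖z * t‖ < 1 := by
    rw [norm_mul, hz, one_mul, Complex.norm_real, Real.norm_of_nonneg ht.1.le]
    exact ht.2
  rw [← (Complex.hasSum_taylorSeries_neg_log hnorm).tsum_eq]
  refine tsum_congr fun n => ?_
  rw [mul_pow]; ring

lemma expZeta_one {x : ℝ} (hx : (x : UnitAddCircle) ≠ 0)
    (hx1 : Complex.exp (2 * Real.pi * Complex.I * x) ≠ 1) :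
    HurwitzZeta.expZeta x 1 =
      -Complex.log (1 - Complex.exp (2 * Real.pi * Complex.I * x)) := by
  set z := Complex.exp (2 * Real.pi * Complex.I * x) with hzdef
  have hz : ‖z‖ = 1 := by
    rw [hzdef, show 2 * (Real.pi : ℂ) * Complex.I * x = ((2 * Real.pi * x : ℝ) : ℂ) * Complex.I by
      push_cast; ring]
    exact Complex.norm_exp_ofReal_mul_I _
  rw [← mul_abelSum_one hz hx1]
  have hcont : Tendsto (fun s : ℝ => HurwitzZeta.expZeta x (s : ℂ)) (𝓝[>] 1)
      (𝓝 (HurwitzZeta.expZeta x 1)) := by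
    have h1 := (HurwitzZeta.differentiableAt_expZeta (x : UnitAddCircle) 1
      (Or.inr hx)).continuousAt.tendsto
    have h2 : Tendsto (fun s : ℝ => (s : ℂ)) (𝓝[>] 1) (𝓝 1) :=
      (Complex.continuous_ofReal.tendsto' 1 1 (by simp)).mono_left nhdsWithin_le_nhds
    exact h1.comp h2
  refine tendsto_nhds_unique hcont (((tendsto_abelSum hz hx1).const_mul z).congr' ?_)
  filter_upwards [Ioc_mem_nhdsGT (show (1 : ℝ) < 2 by norm_num)] with s hs
  have h1 := (HurwitzZeta.hasSum_expZeta_of_one_lt_re x (s := (s : ℂ))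
    (by simpa using hs.1)).tendsto_sum_nat
  rw [← tendsto_add_atTop_iff_nat 1] at h1
  refine tendsto_nhds_unique
    ((tendsto_partialSum_abelSum hz hx1 hs.1.le hs.2).const_mul z) (h1.congr fun N => ?_)
  rw [Finset.sum_range_succ', Finset.mul_sum]
  have hs0 : (s : ℂ) ≠ 0 := by exact_mod_cast (by linarith [hs.1] : s ≠ 0)
  simp only [Nat.cast_zero, Complex.zero_cpow hs0, div_zero, add_zero]
  refine Finset.sum_congr rfl fun i _ => ?_
  have : ((i + 1 : ℕ) : ℂ) ^ (s : ℂ) = ((((i : ℝ) + 1) ^ s : ℝ) : ℂ) := by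
    rw [Complex.ofReal_cpow (by positivity)]; push_cast; rfl
  rw [this, dirichletCoeff, hzdef, mul_comm _ (((i + 1 : ℕ) : ℂ)), Complex.exp_nat_mul, pow_succ]
  push_cast
  ring

lemma expZeta_toAddCircle_one {m : ℕ} [NeZero m] {j : ZMod m} (hj : j ≠ 0) :
    HurwitzZeta.expZeta (ZMod.toAddCircle j) 1 = -Complex.log (1 - ZMod.stdAddChar j) := by
  have hchar : Complex.exp (2 * Real.pi * Complex.I * ((j.val / m : ℝ) : ℂ)) =
      ZMod.stdAddChar j := by
    rw [ZMod.stdAddChar_apply, ZMod.toCircle_apply]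
    push_cast
    congr 1; ring
  have hj1 : ZMod.stdAddChar j ≠ 1 := by
    intro h
    apply hj
    apply ZMod.injective_stdAddChar
    rw [h, AddChar.map_zero_eq_one]
  rw [← hchar] at hj1 ⊢
  rw [ZMod.toAddCircle_apply]
  apply expZeta_one _ hj1
  rw [← ZMod.toAddCircle_apply]
  simpa using hj

end

/-- `1 - e(x)` for the standard additive character `e` of `ZMod m`. -/
noncomputable def oneSubChar {m : ℕ} [NeZero m] (x : ZMod m) : ℂ := 1 - ZMod.stdAddChar x

/-- `log ‖1 - e(x)‖` for the standard additive character `e` of `ZMod m`. -/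
noncomputable def logNorm {m : ℕ} [NeZero m] (x : ZMod m) : ℝ :=
  Real.log ‖oneSubChar x‖

lemma oneSubChar_ne_zero {m : ℕ} [NeZero m] {x : ZMod m} (hx : x ≠ 0) : oneSubChar x ≠ 0 := by
  intro h
  apply hx
  apply ZMod.injective_stdAddChar
  rw [AddChar.map_zero_eq_one]
  exact (sub_eq_zero.1 h).symm

lemma oneSubChar_unit_mul_ne_zero {m : ℕ} [NeZero m] (w : (ZMod m)ˣ) {x : ZMod m} (hx : x ≠ 0) :
    oneSubChar ((w : ZMod m) * x) ≠ 0 :=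
  oneSubChar_ne_zero (by rwa [Ne, Units.mul_right_eq_zero])

lemma oneSubChar_neg {m : ℕ} [NeZero m] (x : ZMod m) :
    oneSubChar (-x) = -(ZMod.stdAddChar (-x) * oneSubChar x) := by
  rw [oneSubChar, oneSubChar, mul_sub, mul_one, ← AddChar.map_add_eq_mul]
  simp

lemma logNorm_zero {m : ℕ} [NeZero m] : logNorm (0 : ZMod m) = 0 := by
  simp [logNorm, oneSubChar]

lemma expZeta_add_expZeta_neg {m : ℕ} [NeZero m] {x : ZMod m} (hx : x ≠ 0) :
    HurwitzZeta.expZeta (ZMod.toAddCircle x) 1 + HurwitzZeta.expZeta (ZMod.toAddCircle (-x)) 1 =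
      -2 * logNorm x := by
  rw [expZeta_toAddCircle_one hx, expZeta_toAddCircle_one (neg_ne_zero.2 hx)]
  have hne : oneSubChar x ≠ 0 := oneSubChar_ne_zero hx
  rw [oneSubChar] at hne
  have hconj : (1 - ZMod.stdAddChar (-x) : ℂ) = (starRingEnd ℂ) (1 - ZMod.stdAddChar x) := by
    rw [map_sub, map_one, AddChar.map_neg_eq_conj]
  have hslit := one_sub_mem_slitPlane (z := ZMod.stdAddChar x) (by simp)
    (fun h => hne (by rw [h, sub_self]))
  rw [hconj, Complex.log_conj _ (Complex.mem_slitPlane_iff_arg.1 hslit).1, ← neg_add,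
    Complex.add_conj, Complex.log_re, logNorm, oneSubChar]
  push_cast
  ring

lemma sum_dft_mul_logNorm_ne_zero {m : ℕ} [NeZero m] {χ : DirichletCharacter ℂ m}
    (hχ : χ ≠ 1) (heven : χ.Even) :
    ∑ x : ZMod m, ZMod.dft (fun j => χ j) x * (logNorm x : ℂ) ≠ 0 := by
  set Ψ := ZMod.dft (fun j : ZMod m => χ j) with hΨ
  have hΨeven : ∀ x, Ψ (-x) = Ψ x := by
    have : Function.Even Ψ := by
      rw [hΨ, ZMod.dft_even_iff]
      exact heven.to_fun
    exact this
  have hΨ0 : Ψ 0 = 0 := by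
    rw [hΨ, ZMod.dft_apply_zero]
    exact MulChar.sum_eq_zero_of_ne_one hχ
  have hL := DirichletCharacter.LFunction_apply_one_ne_zero hχ
  have hdd : ZMod.dft Ψ = fun j => (m : ℂ) * χ j := by
    rw [hΨ, ZMod.dft_dft]
    funext j
    rw [smul_eq_mul, heven.eval_neg]
  have h1 := ZMod.LFunction_dft Ψ (s := 1) (Or.inl hΨ0)
  have h2 : ZMod.LFunction (ZMod.dft Ψ) 1 = m * DirichletCharacter.LFunction χ 1 := by
    rw [hdd, DirichletCharacter.LFunction, ZMod.LFunction, ZMod.LFunction, Finset.mul_sum,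
      Finset.mul_sum, Finset.mul_sum]
    refine Finset.sum_congr rfl fun j _ => ?_
    ring
  have h3 : ∑ j, Ψ j * HurwitzZeta.expZeta (ZMod.toAddCircle (-j)) 1 =
      ∑ j, Ψ j * HurwitzZeta.expZeta (ZMod.toAddCircle j) 1 := by
    rw [← Equiv.sum_comp (Equiv.neg (ZMod m))]
    refine Finset.sum_congr rfl fun j _ => ?_
    simp [hΨeven]
  have h4 : 2 * ((m : ℂ) * DirichletCharacter.LFunction χ 1) =
      -2 * ∑ x : ZMod m, Ψ x * (logNorm x : ℂ) := by
    rw [← h2, h1, two_mul]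
    nth_rw 1 [h3]
    rw [← Finset.sum_add_distrib, Finset.mul_sum]
    refine Finset.sum_congr rfl fun x _ => ?_
    rcases eq_or_ne x 0 with rfl | hx
    · simp [hΨ0]
    · rw [← mul_add, expZeta_add_expZeta_neg hx]; ring
  intro h
  rw [h, mul_zero] at h4
  have hm : (m : ℂ) ≠ 0 := NeZero.ne _
  simp [hm, hL] at h4

lemma sum_dft_mul_logNorm_unit_mul {m : ℕ} [NeZero m] (χ : DirichletCharacter ℂ m)
    (w : (ZMod m)ˣ) :
    ∑ x : ZMod m, ZMod.dft (fun j => χ j) x * (logNorm ((w : ZMod m) * x) : ℂ) =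
      χ w * ∑ x : ZMod m, ZMod.dft (fun j => χ j) x * (logNorm x : ℂ) := by
  have h : ∀ x, ZMod.dft (fun j => χ j) (((w⁻¹ : (ZMod m)ˣ) : ZMod m) * x) =
      χ w * ZMod.dft (fun j => χ j) x := by
    intro x
    rw [← ZMod.dft_comp_unitMul (fun j => χ j) w x]
    simp only [map_mul]
    rw [ZMod.dft_const_mul]
  rw [Finset.mul_sum, ← Equiv.sum_comp (Units.mulLeft w)
    (fun x => χ w * (ZMod.dft (fun j => χ j) x * (logNorm x : ℂ)))]
  refine Finset.sum_congr rfl fun x _ => ?_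
  rw [← mul_assoc, Units.mulLeft_apply, ← h, Units.inv_mul_cancel_left]

lemma sum_char_eq_of_prod_eq {m : ℕ} [NeZero m] {ι κ : Type*} {s : Finset ι} {t : Finset κ}
    (hst : s.card = t.card) {p : ι → (ZMod m)ˣ} {q : κ → (ZMod m)ˣ}
    (h : ∀ x : ZMod m, x ≠ 0 → ∏ i ∈ s, oneSubChar ((p i : ZMod m) * x) =
      ∏ j ∈ t, oneSubChar ((q j : ZMod m) * x))
    {χ : DirichletCharacter ℂ m} (heven : χ.Even) :
    ∑ i ∈ s, χ (p i) = ∑ j ∈ t, χ (q j) := by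
  rcases eq_or_ne χ 1 with rfl | hχ
  · simp [MulChar.one_apply_coe, hst]
  have hne : ∀ (w : (ZMod m)ˣ) {x : ZMod m}, x ≠ 0 → ‖oneSubChar ((w : ZMod m) * x)‖ ≠ 0 :=
    fun w x hx => norm_ne_zero_iff.2 (oneSubChar_unit_mul_ne_zero w hx)
  have hlog : ∀ x : ZMod m, ∑ i ∈ s, logNorm ((p i : ZMod m) * x) =
      ∑ j ∈ t, logNorm ((q j : ZMod m) * x) := by
    intro x
    rcases eq_or_ne x 0 with rfl | hx
    · simp [logNorm_zero]
    · simp only [logNorm]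
      rw [← Real.log_prod (fun i _ => hne _ hx), ← Real.log_prod (fun i _ => hne _ hx),
        ← norm_prod, ← norm_prod, h x hx]
  apply mul_right_cancel₀ (sum_dft_mul_logNorm_ne_zero hχ heven)
  simp only [Finset.sum_mul, ← sum_dft_mul_logNorm_unit_mul]
  rw [Finset.sum_comm, Finset.sum_comm (s := t)]
  refine Finset.sum_congr rfl fun x _ => ?_
  rw [← Finset.mul_sum, ← Finset.mul_sum, ← Complex.ofReal_sum, ← Complex.ofReal_sum, hlog]

lemma sum_even_eq_of_prod_eq {m : ℕ} [NeZero m] {ι κ : Type*} {s : Finset ι} {t : Finset κ}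
    (hst : s.card = t.card) {p : ι → (ZMod m)ˣ} {q : κ → (ZMod m)ˣ}
    (h : ∀ x : ZMod m, x ≠ 0 → ∏ i ∈ s, oneSubChar ((p i : ZMod m) * x) =
      ∏ j ∈ t, oneSubChar ((q j : ZMod m) * x))
    {F : (ZMod m)ˣ → ℂ} (hF : ∀ w, F (-w) = F w) :
    ∑ i ∈ s, F (p i) = ∑ j ∈ t, F (q j) := by
  have hφ : (m.totient : ℂ) ≠ 0 := by
    exact_mod_cast (Nat.totient_pos.2 (Nat.pos_of_ne_zero (NeZero.ne m))).ne'
  have hexp : ∀ w, (m.totient : ℂ) * F w =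
      ∑ χ : DirichletCharacter ℂ m, (∑ y : (ZMod m)ˣ, F y * χ ((y⁻¹ : (ZMod m)ˣ) : ZMod m)) *
        χ w := by
    intro w
    simp only [Finset.sum_mul]
    rw [Finset.sum_comm, Finset.sum_eq_single w]
    · simp only [mul_assoc, ← Finset.mul_sum]
      have := DirichletCharacter.sum_char_inv_mul_char_eq ℂ w.isUnit (w : ZMod m)
      simp only [ZMod.inv_coe_unit, if_true] at this
      rw [this, mul_comm]
    · intro y _ hy
      simp only [mul_assoc, ← Finset.mul_sum]
      have := DirichletCharacter.sum_char_inv_mul_char_eq ℂ y.isUnit (w : ZMod m)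
      simp only [ZMod.inv_coe_unit, Units.val_inj, if_neg hy] at this
      rw [this, mul_zero]
    · simp
  apply mul_left_cancel₀ hφ
  rw [Finset.mul_sum, Finset.mul_sum]
  simp only [hexp]
  rw [Finset.sum_comm, Finset.sum_comm (s := t)]
  refine Finset.sum_congr rfl fun χ _ => ?_
  rw [← Finset.mul_sum, ← Finset.mul_sum]
  rcases χ.even_or_odd with heven | hodd
  · rw [sum_char_eq_of_prod_eq hst h heven]
  · have h0 : ∑ y : (ZMod m)ˣ, F y * χ ((y⁻¹ : (ZMod m)ˣ) : ZMod m) = 0 := by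
      rw [← self_eq_neg, ← Finset.sum_neg_distrib]
      conv_lhs => rw [← Equiv.sum_comp (Equiv.neg (ZMod m)ˣ)]
      refine Finset.sum_congr rfl fun y _ => ?_
      simp [hF, inv_neg, hodd.eval_neg]
    rw [h0, zero_mul, zero_mul]

lemma pow_mul_pow_mem_geomNS (a b : ℕ) {i k : ℕ} (hi : i ≤ k) :
    a ^ (k - i) * b ^ i ∈ geomNS a b k :=
  AddSubmonoid.subset_closure ⟨i, hi, rfl⟩

lemma left_pow_mem_geomNS (a b k : ℕ) : a ^ k ∈ geomNS a b k := by
  simpa using pow_mul_pow_mem_geomNS a b (Nat.zero_le k)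

lemma right_pow_mem_geomNS (a b k : ℕ) : b ^ k ∈ geomNS a b k := by
  simpa using pow_mul_pow_mem_geomNS a b (le_refl k)

lemma mem_geomNS_succ_iff {a b k n : ℕ} (ha : 0 < a) :
    n ∈ geomNS a b (k + 1) ↔ ∃ c < a, ∃ t ∈ geomNS a b k, c * b ^ (k + 1) + a * t = n := by
  have hbk := right_pow_mem_geomNS a b k
  constructor
  · intro hn
    suffices h : ∃ c, ∃ t ∈ geomNS a b k, c * b ^ (k + 1) + a * t = n by
      obtain ⟨c, t, ht, rfl⟩ := h
      refine ⟨c % a, Nat.mod_lt _ ha, (c / a * b) • b ^ k + t,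
        add_mem (AddSubmonoid.nsmul_mem _ hbk _) ht, ?_⟩
      conv_rhs => rw [← Nat.mod_add_div c a]
      simp only [smul_eq_mul]
      ring
    induction hn using AddSubmonoid.closure_induction with
    | mem x hx =>
      obtain ⟨i, hi, rfl⟩ := hx
      rcases Nat.lt_or_eq_of_le (Set.mem_Iic.1 hi) with h | rfl
      · refine ⟨0, a ^ (k - i) * b ^ i, pow_mul_pow_mem_geomNS a b
          (Nat.lt_succ_iff.1 h), ?_⟩
        simp only [Nat.succ_sub (Nat.lt_succ_iff.1 h), pow_succ]
        ring
      · exact ⟨1, 0, zero_mem _, by simp⟩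
    | zero => exact ⟨0, 0, zero_mem _, by simp⟩
    | add x y _ _ hx hy =>
      obtain ⟨c, t, ht, rfl⟩ := hx
      obtain ⟨d, s, hs, rfl⟩ := hy
      exact ⟨c + d, t + s, add_mem ht hs, by ring⟩
  · rintro ⟨c, -, t, ht, rfl⟩
    apply add_mem
    · exact AddSubmonoid.nsmul_mem _ (right_pow_mem_geomNS a b (k + 1)) c
    · induction ht using AddSubmonoid.closure_induction with
      | mem x hx =>
        obtain ⟨i, hi, rfl⟩ := hx
        refine AddSubmonoid.subset_closure ⟨i, Set.mem_Iic.2 (Nat.le_succ_of_le hi), ?_⟩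
        simp only [Nat.succ_sub (Set.mem_Iic.1 hi), pow_succ]
        ring
      | zero => simp
      | add x y _ _ hx hy => rw [mul_add]; exact add_mem hx hy

/-- The elements of `geomNS a b (k + 1)`, uniquely written as `c * b ^ (k + 1) + a * t`
with `c < a` and `t ∈ geomNS a b k`. -/
noncomputable def geomNSSuccEquiv {a b : ℕ} (k : ℕ) (ha : 0 < a) (hab : Nat.Coprime a b) :
    Fin a × geomNS a b k ≃ geomNS a b (k + 1) :=
  Equiv.ofBijective
    (fun p => ⟨p.1 * b ^ (k + 1) + a * p.2,
      (mem_geomNS_succ_iff ha).2 ⟨p.1, p.1.2, p.2, p.2.2, rfl⟩⟩) <| by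
    constructor
    · rintro ⟨⟨c, hc⟩, ⟨t, ht⟩⟩ ⟨⟨d, hd⟩, ⟨s, hs⟩⟩ h
      simp only [Subtype.mk.injEq] at h
      have hmod : c * b ^ (k + 1) ≡ d * b ^ (k + 1) [MOD a] := by
        have h1 : (c * b ^ (k + 1) + a * t) % a = (d * b ^ (k + 1) + a * s) % a := by rw [h]
        simpa [Nat.ModEq, Nat.add_mul_mod_self_left] using h1
      have hcd : c = d := by
        have h2 := Nat.ModEq.cancel_right_of_coprime (hab.pow_right (k + 1)) hmod
        exact Nat.ModEq.eq_of_lt_of_lt h2 hc hd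
      subst hcd
      have hts : t = s := Nat.eq_of_mul_eq_mul_left ha (Nat.add_left_cancel h)
      subst hts
      rfl
    · rintro ⟨n, hn⟩
      obtain ⟨c, hc, t, ht, h⟩ := (mem_geomNS_succ_iff ha).1 hn
      exact ⟨(⟨c, hc⟩, ⟨t, ht⟩), Subtype.ext h⟩

lemma summable_pow_subtype {x : ℂ} (hx : ‖x‖ < 1) (T : Set ℕ) :
    Summable fun t : T => x ^ (t : ℕ) :=
  (summable_geometric_of_norm_lt_one hx).subtype T

lemma tsum_geomNS_succ {a b k : ℕ} (ha : 0 < a) (hab : Nat.Coprime a b) {x : ℂ}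
    (hx : ‖x‖ < 1) :
    ∑' t : geomNS a b (k + 1), x ^ (t : ℕ) =
      (∑ c ∈ Finset.range a, (x ^ b ^ (k + 1)) ^ c) * ∑' t : geomNS a b k, (x ^ a) ^ (t : ℕ) := by
  have hs : Summable fun t : geomNS a b (k + 1) => x ^ (t : ℕ) :=
    summable_pow_subtype hx (geomNS a b (k + 1) : Set ℕ)
  have hsum : Summable fun p : Fin a × geomNS a b k =>
      x ^ ((geomNSSuccEquiv k ha hab p : geomNS a b (k + 1)) : ℕ) :=
    hs.comp_injective (geomNSSuccEquiv k ha hab).injective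
  rw [← (geomNSSuccEquiv k ha hab).tsum_eq, hsum.tsum_prod, tsum_fintype, Finset.sum_mul,
    ← Fin.sum_univ_eq_sum_range
      (fun c => (x ^ b ^ (k + 1)) ^ c * ∑' t : geomNS a b k, (x ^ a) ^ (t : ℕ))]
  refine Finset.sum_congr rfl fun c _ => ?_
  rw [← tsum_mul_left]
  refine tsum_congr fun t => ?_
  change x ^ ((c : ℕ) * b ^ (k + 1) + a * t) = _
  rw [pow_add, pow_mul, pow_mul, ← pow_mul, mul_comm (c : ℕ), pow_mul]

lemma tsum_geomNS_mul_prod {a b : ℕ} (ha : 0 < a) (hab : Nat.Coprime a b) (k : ℕ) {x : ℂ}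
    (hx : ‖x‖ < 1) :
    (∑' t : geomNS a b k, x ^ (t : ℕ)) *
        ∏ i ∈ Finset.range (k + 1), (1 - x ^ (a ^ (k - i) * b ^ i)) =
      ∏ i ∈ Finset.range k, (1 - x ^ (a ^ (k - i) * b ^ (i + 1))) := by
  induction k generalizing x with
  | zero =>
    have htop : (geomNS a b 0 : Set ℕ) = Set.univ := by
      refine Set.eq_univ_of_forall fun n => ?_
      have h1 : 1 ∈ geomNS a b 0 := AddSubmonoid.subset_closure ⟨0, by simp, by simp⟩
      simpa using AddSubmonoid.nsmul_mem _ h1 n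
    have h : ∑' t : geomNS a b 0, x ^ (t : ℕ) = (1 - x)⁻¹ := by
      rw [← tsum_geometric_of_norm_lt_one hx]
      change ∑' t : (geomNS a b 0 : Set ℕ), x ^ (t : ℕ) = _
      rw [htop]
      exact tsum_univ (fun n : ℕ => x ^ n)
    have hx1 : 1 - x ≠ 0 := by
      rw [sub_ne_zero]
      rintro rfl
      simp at hx
    simp [h, inv_mul_cancel₀ hx1]
  | succ k ih =>
    have hxa : ‖x ^ a‖ < 1 := by
      rw [norm_pow]
      exact pow_lt_one₀ (norm_nonneg _) hx ha.ne'
    rw [tsum_geomNS_succ ha hab hx, Finset.prod_range_succ _ (k + 1),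
      Finset.prod_range_succ (fun i => 1 - x ^ (a ^ (k + 1 - i) * b ^ (i + 1))) k]
    have e1 : ∏ i ∈ Finset.range (k + 1), (1 - x ^ (a ^ (k + 1 - i) * b ^ i)) =
        ∏ i ∈ Finset.range (k + 1), (1 - (x ^ a) ^ (a ^ (k - i) * b ^ i)) := by
      refine Finset.prod_congr rfl fun i hi => ?_
      rw [Nat.succ_sub (Nat.lt_succ_iff.1 (Finset.mem_range.1 hi)), ← pow_mul, pow_succ]
      ring_nf
    have e2 : ∏ i ∈ Finset.range k, (1 - x ^ (a ^ (k + 1 - i) * b ^ (i + 1))) =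
        ∏ i ∈ Finset.range k, (1 - (x ^ a) ^ (a ^ (k - i) * b ^ (i + 1))) := by
      refine Finset.prod_congr rfl fun i hi => ?_
      rw [Nat.succ_sub (Finset.mem_range.1 hi).le, ← pow_mul, pow_succ]
      ring_nf
    have e3 := geom_sum_mul_neg (x ^ b ^ (k + 1)) a
    have e4 : 1 - (x ^ b ^ (k + 1)) ^ a = 1 - x ^ (a ^ (k + 1 - k) * b ^ (k + 1)) := by
      rw [← pow_mul, Nat.add_sub_cancel_left, pow_one, mul_comm]
    rw [e1, e2, ← ih hxa, ← e4, ← e3, Nat.sub_self, pow_zero, one_mul]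
    ring

lemma finite_gaps_geomNS {a b : ℕ} (hab : Nat.Coprime a b) (k : ℕ) :
    {n : ℕ | n ∉ geomNS a b k}.Finite := by
  refine (Set.finite_lt_nat ((a ^ k - 1) * (b ^ k - 1))).subset fun n hn => ?_
  by_contra hlt
  obtain ⟨c, d, h⟩ := Nat.exists_add_mul_eq_of_gcd_dvd_of_mul_pred_le (a ^ k) (b ^ k) n
    (by rw [(hab.pow k k : Nat.gcd _ _ = 1)]; exact one_dvd _) (not_lt.1 hlt)
  refine hn (h ▸ add_mem ?_ ?_)
  · exact AddSubmonoid.nsmul_mem _ (left_pow_mem_geomNS a b k) c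
  · exact AddSubmonoid.nsmul_mem _ (right_pow_mem_geomNS a b k) d

lemma gapSum_mul_prod {a b : ℕ} (ha : 0 < a) (hab : Nat.Coprime a b) (k : ℕ) {x : ℂ}
    (hx : ‖x‖ ≤ 1) :
    (1 - (1 - x) * ∑ n ∈ (finite_gaps_geomNS hab k).toFinset, x ^ n) *
        ∏ i ∈ Finset.range (k + 1), (1 - x ^ (a ^ (k - i) * b ^ i)) =
      (1 - x) * ∏ i ∈ Finset.range k, (1 - x ^ (a ^ (k - i) * b ^ (i + 1))) := by
  have hball : Set.EqOn
      (fun x : ℂ => (1 - (1 - x) * ∑ n ∈ (finite_gaps_geomNS hab k).toFinset, x ^ n) *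
        ∏ i ∈ Finset.range (k + 1), (1 - x ^ (a ^ (k - i) * b ^ i)))
      (fun x => (1 - x) * ∏ i ∈ Finset.range k, (1 - x ^ (a ^ (k - i) * b ^ (i + 1))))
      (Metric.ball 0 1) := by
    intro x hx
    rw [mem_ball_zero_iff] at hx
    have hx1 : 1 - x ≠ 0 := by
      rw [sub_ne_zero]
      rintro rfl
      simp at hx
    have hsplit := (summable_pow_subtype hx (geomNS a b k : Set ℕ)).tsum_add_tsum_compl
      (summable_pow_subtype hx (geomNS a b k : Set ℕ)ᶜ)
    have hgap : ∑' t : ((geomNS a b k : Set ℕ)ᶜ : Set ℕ), x ^ (t : ℕ) =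
        ∑ n ∈ (finite_gaps_geomNS hab k).toFinset, x ^ n := by
      rw [← Finset.tsum_subtype', Set.Finite.coe_toFinset]
      rfl
    rw [hgap, tsum_geometric_of_norm_lt_one hx] at hsplit
    have h := tsum_geomNS_mul_prod ha hab k hx
    change (1 - (1 - x) * _) * _ = (1 - x) * _
    rw [← h, ← mul_assoc]
    congr 1
    have h2 : ∑' t : geomNS a b k, x ^ (t : ℕ) =
      (1 - x)⁻¹ - ∑ n ∈ (finite_gaps_geomNS hab k).toFinset, x ^ n := by
      rw [← hsplit, add_sub_cancel_right]
      rfl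
    rw [h2, mul_sub, mul_inv_cancel₀ hx1]
  have hcl := hball.closure (by fun_prop) (by fun_prop)
  rw [closure_ball _ one_ne_zero] at hcl
  exact hcl (mem_closedBall_zero_iff.2 hx)

lemma forall_eq_iff_dft_eq_zero {m : ℕ} [NeZero m] (Φ : ZMod m → ℂ) :
    (∀ r s, Φ r = Φ s) ↔ ∀ x ≠ 0, ZMod.dft Φ x = 0 := by
  constructor
  · intro h x hx
    have hc : Φ = fun _ => Φ 0 := funext fun r => h r 0
    rw [ZMod.dft_apply, hc]
    simp only [smul_eq_mul, ← Finset.sum_mul]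
    convert zero_mul _
    have := AddChar.sum_mulShift (-x) (ZMod.isPrimitive_stdAddChar m)
    rw [if_neg (neg_ne_zero.2 hx)] at this
    simpa using this
  · intro h
    have key : ∀ r, Φ r = (m : ℂ)⁻¹ * ZMod.dft Φ 0 := by
      intro r
      conv_lhs => rw [← LinearEquiv.symm_apply_apply ZMod.dft Φ]
      rw [ZMod.invDFT_apply, Finset.sum_eq_single 0]
      · simp
      · intro x _ hx
        rw [h x hx, smul_zero]
      · simp
    intro r s
    rw [key r, key s]

lemma equidistMod_iff {m : ℕ} [NeZero m] {T : Set ℕ} (hT : T.Finite) :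
    EquidistMod T m ↔
      ∀ x : ZMod m, x ≠ 0 → ∑ n ∈ hT.toFinset, (ZMod.stdAddChar x : ℂ) ^ n = 0 := by
  classical
  have hcard : ∀ r : ZMod m, Nat.card {n : ℕ // n ∈ T ∧ (n : ZMod m) = r} =
      (hT.toFinset.filter fun n : ℕ => (n : ZMod m) = r).card := by
    intro r
    exact Nat.subtype_card _ fun n => by simp
  have hdft : ∀ x : ZMod m, ZMod.dft (fun r : ZMod m =>
      ((Nat.card {n : ℕ // n ∈ T ∧ (n : ZMod m) = r} : ℕ) : ℂ)) (-x) =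
      ∑ n ∈ hT.toFinset, (ZMod.stdAddChar x : ℂ) ^ n := by
    intro x
    rw [ZMod.dft_apply, ← Finset.sum_fiberwise hT.toFinset (fun n : ℕ => (n : ZMod m))]
    refine Finset.sum_congr rfl fun r _ => ?_
    rw [hcard, smul_eq_mul, mul_comm, ← nsmul_eq_mul, ← Finset.sum_const]
    refine Finset.sum_congr rfl fun n hn => ?_
    rw [← (Finset.mem_filter.1 hn).2, ← AddChar.map_nsmul_eq_pow]
    simp
  have h := forall_eq_iff_dft_eq_zero (fun r : ZMod m =>
      ((Nat.card {n : ℕ // n ∈ T ∧ (n : ZMod m) = r} : ℕ) : ℂ))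
  simp only [Nat.cast_inj] at h
  rw [EquidistMod, h]
  constructor
  · intro h x hx
    rw [← hdft]
    exact h _ (neg_ne_zero.2 hx)
  · intro h x hx
    rw [← neg_neg x, hdft]
    exact h _ (neg_ne_zero.2 hx)

/-- The product identity that expresses equidistribution of the gaps modulo `m`. -/
def GapProdEq {m : ℕ} [NeZero m] (k : ℕ) (u v : (ZMod m)ˣ) : Prop :=
  ∀ x : ZMod m, x ≠ 0 →
    oneSubChar x * ∏ i ∈ Finset.range k,
        oneSubChar (((u ^ (k - i) * v ^ (i + 1) : (ZMod m)ˣ) : ZMod m) * x) =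
      ∏ i ∈ Finset.range (k + 1),
        oneSubChar (((u ^ (k - i) * v ^ i : (ZMod m)ˣ) : ZMod m) * x)

lemma equidistMod_gaps_iff {a b m : ℕ} [NeZero m] (ha : 0 < a) (hab : Nat.Coprime a b) (k : ℕ)
    {u v : (ZMod m)ˣ} (hu : (u : ZMod m) = a) (hv : (v : ZMod m) = b) :
    EquidistMod {n : ℕ | n ∉ geomNS a b k} m ↔ GapProdEq k u v := by
  rw [equidistMod_iff (finite_gaps_geomNS hab k)]
  refine forall₂_congr fun x hx => ?_
  have hpow : ∀ i j : ℕ, (ZMod.stdAddChar x : ℂ) ^ (a ^ i * b ^ j) =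
      ZMod.stdAddChar (((u ^ i * v ^ j : (ZMod m)ˣ) : ZMod m) * x) := by
    intro i j
    rw [← AddChar.map_nsmul_eq_pow]
    congr 1
    push_cast
    rw [hu, hv, nsmul_eq_mul]
    push_cast
    rfl
  have h := gapSum_mul_prod ha hab k (x := ZMod.stdAddChar x) (by simp)
  have hfold : ∀ y : ZMod m, (1 - ZMod.stdAddChar y : ℂ) = oneSubChar y := fun _ => rfl
  simp only [hpow, hfold] at h
  rw [← h]
  have hP : ∏ i ∈ Finset.range (k + 1),
      oneSubChar (((u ^ (k - i) * v ^ i : (ZMod m)ˣ) : ZMod m) * x) ≠ 0 := by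
    exact Finset.prod_ne_zero_iff.2 fun i _ => oneSubChar_unit_mul_ne_zero _ hx
  constructor
  · intro h0
    rw [h0]; ring
  · intro h1
    have h2 := mul_right_cancel₀ hP (h1.trans (one_mul _).symm)
    simpa [oneSubChar_ne_zero hx] using h2

lemma mul_prod_range_telescope {M : Type*} [CommGroup M] {k : ℕ} {f h : ℕ → M} {p q : M}
    (hp : p * ∏ i ∈ Finset.range k, f i = ∏ i ∈ Finset.range (k + 1), h i)
    (hq : q * ∏ i ∈ Finset.range k, f (i + 1) = ∏ i ∈ Finset.range (k + 1), h (i + 1)) :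
    p * f 0 * h (k + 1) = q * f k * h 0 := by
  have hf := (Finset.prod_range_succ f k).symm.trans (Finset.prod_range_succ' f k)
  have hh := (Finset.prod_range_succ h (k + 1)).symm.trans (Finset.prod_range_succ' h (k + 1))
  rw [← hp, ← hq] at hh
  refine mul_right_cancel (b := (∏ i ∈ Finset.range k, f i) *
    ∏ i ∈ Finset.range k, f (i + 1)) ?_
  calc p * f 0 * h (k + 1) * ((∏ i ∈ Finset.range k, f i) * ∏ i ∈ Finset.range k, f (i + 1))
      = (p * (∏ i ∈ Finset.range k, f i) * h (k + 1)) *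
        ((∏ i ∈ Finset.range k, f (i + 1)) * f 0) := by ac_rfl
    _ = (q * (∏ i ∈ Finset.range k, f (i + 1)) * h 0) *
        ((∏ i ∈ Finset.range k, f i) * f k) := by rw [hh, hf]
    _ = _ := by ac_rfl

lemma six_term_of_prod_eq {M Q : Type*} [CommGroup M] [CommGroup Q] {k : ℕ} {u v : Q} {G : Q → M}
    (H : ∀ w, G w * ∏ i ∈ Finset.range k, G (w * (u ^ (k - i) * v ^ (i + 1))) =
      ∏ i ∈ Finset.range (k + 1), G (w * (u ^ (k - i) * v ^ i))) :
    G u * G (u ^ (k + 1) * v) * G (v ^ (k + 1)) =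
      G v * G (u * v ^ (k + 1)) * G (u ^ (k + 1)) := by
  have key := mul_prod_range_telescope (k := k)
    (f := fun i => G (u ^ (k + 1 - i) * v ^ (i + 1)))
    (h := fun i => G (u ^ (k + 1 - i) * v ^ i)) (p := G u) (q := G v) ?_ ?_
  · simpa using key
  · have e : ∀ i j : ℕ, i ≤ k → u * (u ^ (k - i) * v ^ j) = u ^ (k + 1 - i) * v ^ j := by
      intro i j hi
      rw [← mul_assoc, ← pow_succ', Nat.succ_sub hi]
    convert H u using 2
    · exact Finset.prod_congr rfl fun i hi => by rw [e _ _ (Finset.mem_range.1 hi).le]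
    · rename_i i hi
      rw [e _ _ (Finset.mem_range_succ_iff.1 hi)]
  · have e : ∀ i j : ℕ, v * (u ^ (k - i) * v ^ j) = u ^ (k + 1 - (i + 1)) * v ^ (j + 1) := by
      intro i j
      rw [mul_left_comm, ← pow_succ', Nat.add_sub_add_right]
    simpa only [e] using H v

lemma eq_of_six_term {Q : Type*} [CommGroup Q] {k : ℕ} {u v : Q}
    (H : ∀ G : Q → ℂ, G u + G (u ^ (k + 1) * v) + G (v ^ (k + 1)) =
      G v + G (u * v ^ (k + 1)) + G (u ^ (k + 1))) :
    u = v ∨ u = 1 ∨ v = 1 ∨ (u ^ k = 1 ∧ v ^ k = 1) ∨ (u ^ (k + 1) = 1 ∧ v ^ (k + 1) = 1) := by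
  classical
  by_cases huv : u = v
  · exact Or.inl huv
  have h1 : v ^ (k + 1) = 1 ∨ u ^ k = 1 := by
    by_contra! hne
    have h := H fun y => if y = u then 1 else 0
    have h2 : u * v ^ (k + 1) ≠ u := by simpa using hne.1
    have h3 : u ^ (k + 1) ≠ u := by simpa [pow_succ] using hne.2
    simp only [if_neg h2, if_neg h3, if_neg (Ne.symm huv), if_true] at h
    split_ifs at h <;> norm_num at h
  rcases h1 with h1 | h1
  · have h4 : v = 1 ∨ u ^ (k + 1) = 1 := by
      by_contra! hne
      have h := H fun y => if y = 1 then 1 else 0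
      simp only [h1, mul_one, if_neg hne.1, if_neg hne.2, if_true] at h
      split_ifs at h <;> norm_num at h
    tauto
  · have h4 : u = 1 ∨ v ^ k = 1 := by
      by_contra! hne
      have h := H fun y => if y = v then 1 else 0
      have h2 : v ^ (k + 1) ≠ v := by simpa [pow_succ] using hne.2
      have h3 : u * v ≠ v := by simpa using hne.1
      simp only [pow_succ u, h1, one_mul, if_neg h2, if_neg h3, if_neg huv, if_true] at h
      split_ifs at h <;> norm_num at h
    tauto

lemma relations_of_sum_eq {Q : Type*} [CommGroup Q] {k : ℕ} (hk : 0 < k) {u v : Q}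
    (H : ∀ F : Q → ℂ, F 1 + ∑ i ∈ Finset.range k, F (u ^ (k - i) * v ^ (i + 1)) =
      ∑ i ∈ Finset.range (k + 1), F (u ^ (k - i) * v ^ i)) :
    u = 1 ∨ v = 1 ∨ (u ^ k = 1 ∧ v ^ k = 1 ∧ u ∈ Subgroup.zpowers (u⁻¹ * v)) ∨
      (u ^ (k + 1) = 1 ∧ v ^ (k + 1) = 1 ∧ u ∈ Subgroup.zpowers (u⁻¹ * v)) := by
  classical
  have hsix : ∀ G : Q → ℂ, G u + G (u ^ (k + 1) * v) + G (v ^ (k + 1)) =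
      G v + G (u * v ^ (k + 1)) + G (u ^ (k + 1)) := by
    intro G
    refine six_term_of_prod_eq (M := Multiplicative ℂ) (G := G) fun w => ?_
    have h := H fun y => G (w * y)
    rw [mul_one] at h
    exact h
  have hpow : ∀ {n i : ℕ}, i ≤ n → u ^ (n - i) * v ^ i = u ^ n * (u⁻¹ * v) ^ i := by
    intro n i hi
    rw [mul_pow, ← mul_assoc, inv_pow, pow_sub _ hi]
  have hR : ∀ (y : Q) (i : ℕ), y * (u⁻¹ * v) ^ i ∈ Subgroup.zpowers (u⁻¹ * v) ↔
      y ∈ Subgroup.zpowers (u⁻¹ * v) := fun y i =>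
    Subgroup.mul_mem_cancel_right _ (Subgroup.npow_mem_zpowers _ _)
  have h := H fun y => if y ∈ Subgroup.zpowers (u⁻¹ * v) then 1 else 0
  have hl : ∀ i ∈ Finset.range k, (if u ^ (k - i) * v ^ (i + 1) ∈ Subgroup.zpowers (u⁻¹ * v)
      then (1 : ℂ) else 0) = if u ^ (k + 1) ∈ Subgroup.zpowers (u⁻¹ * v) then 1 else 0 := by
    intro i hi
    have := hpow (n := k + 1) (i := i + 1) (by simpa using (Finset.mem_range.1 hi).le)
    rw [Nat.add_sub_add_right] at this
    rw [this]
    simp only [hR]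
  have hr : ∀ i ∈ Finset.range (k + 1), (if u ^ (k - i) * v ^ i ∈ Subgroup.zpowers (u⁻¹ * v)
      then (1 : ℂ) else 0) = if u ^ k ∈ Subgroup.zpowers (u⁻¹ * v) then 1 else 0 := by
    intro i hi
    rw [hpow (Finset.mem_range_succ_iff.1 hi)]
    simp only [hR]
  rw [Finset.sum_congr rfl hl, Finset.sum_congr rfl hr, if_pos (Subgroup.one_mem _)] at h
  simp only [Finset.sum_const, Finset.card_range, nsmul_eq_mul] at h
  have hk' : (k : ℂ) ≠ 0 := Nat.cast_ne_zero.2 hk.ne'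
  have hk1 : (k : ℂ) + 1 ≠ 0 := Nat.cast_add_one_ne_zero k
  have hu : u ∈ Subgroup.zpowers (u⁻¹ * v) := by
    push_cast at h
    by_cases h1 : u ^ (k + 1) ∈ Subgroup.zpowers (u⁻¹ * v) <;>
    by_cases h2 : u ^ k ∈ Subgroup.zpowers (u⁻¹ * v)
    · rw [pow_succ'] at h1
      exact (Subgroup.mul_mem_cancel_right _ h2).1 h1
    · simp [h1, h2, add_comm, hk1] at h
    · simp [h1, h2, hk'] at h
    · simp [h1, h2] at h
  rcases eq_of_six_term hsix with h1 | h1 | h1 | h1 | h1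
  · left
    rw [← h1, inv_mul_cancel, Subgroup.zpowers_one_eq_bot] at hu
    exact hu
  · exact Or.inl h1
  · exact Or.inr (Or.inl h1)
  · exact Or.inr (Or.inr (Or.inl ⟨h1.1, h1.2, hu⟩))
  · exact Or.inr (Or.inr (Or.inr ⟨h1.1, h1.2, hu⟩))

lemma mk_eq_one_or_neg_one {m : ℕ} {w : (ZMod m)ˣ}
    (h : (w : (ZMod m)ˣ ⧸ Subgroup.zpowers (-1 : (ZMod m)ˣ)) = 1) : w = 1 ∨ w = -1 := by
  rw [QuotientGroup.eq_one_iff, Subgroup.mem_zpowers_iff] at h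
  obtain ⟨n, rfl⟩ := h
  rcases Int.even_or_odd n with hn | hn
  · exact Or.inl hn.neg_one_zpow
  · exact Or.inr hn.neg_one_zpow

lemma relations_of_prod_eq {m : ℕ} [NeZero m] {k : ℕ} (hk : 0 < k) {u v : (ZMod m)ˣ}
    (H : GapProdEq k u v) :
    (u = 1 ∨ u = -1) ∨ (v = 1 ∨ v = -1) ∨
      ((u ^ k = 1 ∨ u ^ k = -1) ∧ (v ^ k = 1 ∨ v ^ k = -1) ∧
        (u ∈ Subgroup.zpowers (u⁻¹ * v) ∨ -u ∈ Subgroup.zpowers (u⁻¹ * v))) ∨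
      ((u ^ (k + 1) = 1 ∨ u ^ (k + 1) = -1) ∧ (v ^ (k + 1) = 1 ∨ v ^ (k + 1) = -1) ∧
        (u ∈ Subgroup.zpowers (u⁻¹ * v) ∨ -u ∈ Subgroup.zpowers (u⁻¹ * v))) := by
  set N := Subgroup.zpowers (-1 : (ZMod m)ˣ) with hN
  have hmem : (u : (ZMod m)ˣ ⧸ N) ∈ Subgroup.zpowers ((u : (ZMod m)ˣ ⧸ N)⁻¹ * v) →
      u ∈ Subgroup.zpowers (u⁻¹ * v) ∨ -u ∈ Subgroup.zpowers (u⁻¹ * v) := by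
    intro h
    obtain ⟨n, hn⟩ := Subgroup.mem_zpowers_iff.1 h
    have h1 : (((u⁻¹ * v) ^ n * u⁻¹ : (ZMod m)ˣ) : (ZMod m)ˣ ⧸ N) = 1 := by
      rw [QuotientGroup.mk_mul, QuotientGroup.mk_zpow, QuotientGroup.mk_mul, QuotientGroup.mk_inv,
        hn, mul_inv_cancel]
    rcases mk_eq_one_or_neg_one h1 with h2 | h2
    · exact Or.inl ⟨n, mul_inv_eq_one.1 h2⟩
    · refine Or.inr ⟨n, ?_⟩
      rw [← neg_one_mul u, ← h2, inv_mul_cancel_right]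
  have hrel := relations_of_sum_eq hk (u := (u : (ZMod m)ˣ ⧸ N)) (v := (v : (ZMod m)ˣ ⧸ N)) ?_
  · simp only [← QuotientGroup.mk_pow] at hrel
    rcases hrel with h | h | ⟨h1, h2, h3⟩ | ⟨h1, h2, h3⟩
    · exact Or.inl (mk_eq_one_or_neg_one h)
    · exact Or.inr (Or.inl (mk_eq_one_or_neg_one h))
    · exact Or.inr (Or.inr (Or.inl ⟨mk_eq_one_or_neg_one h1, mk_eq_one_or_neg_one h2, hmem h3⟩))
    · exact Or.inr (Or.inr (Or.inr ⟨mk_eq_one_or_neg_one h1, mk_eq_one_or_neg_one h2, hmem h3⟩))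
  · intro F
    have key := sum_even_eq_of_prod_eq (s := Finset.range (k + 1)) (t := Finset.range (k + 1))
      rfl (p := fun i => Nat.casesOn i 1 fun j => u ^ (k - j) * v ^ (j + 1))
      (q := fun i => u ^ (k - i) * v ^ i) ?_ (F := fun w => F (w : (ZMod m)ˣ ⧸ N)) ?_
    · rw [Finset.sum_range_succ', add_comm] at key
      exact key
    · intro x hx
      rw [Finset.prod_range_succ', mul_comm, ← H x hx]
      simp
    · intro w
      congr 1
      rw [QuotientGroup.eq, hN, Subgroup.mem_zpowers_iff]
      exact ⟨1, by simp⟩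

lemma prod_range_mul_pow_eq {G M : Type*} [CommGroup G] [CommMonoid M] {r w : G} {n : ℕ}
    (hr : r ^ n = 1) (hw : w ∈ Subgroup.zpowers r) (h : G → M) :
    ∏ i ∈ Finset.range n, h (w * r ^ i) = ∏ i ∈ Finset.range n, h (r ^ i) := by
  rcases n with _ | n
  · simp
  have hfin : IsOfFinOrder r := isOfFinOrder_iff_pow_eq_one.2 ⟨_, n.succ_pos, hr⟩
  obtain ⟨j, rfl⟩ := (Submonoid.mem_powers_iff _ _).1 (hfin.mem_powers_iff_mem_zpowers.2 hw)
  clear hw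
  induction j with
  | zero => simp
  | succ j ih =>
    rw [← ih, Finset.prod_range_succ, Finset.prod_range_succ', pow_succ' r j, pow_zero, mul_one]
    congr 1
    · refine Finset.prod_congr rfl fun i _ => ?_
      rw [pow_succ' r i, mul_left_comm (r ^ j), mul_assoc]
    · rw [mul_assoc, mul_left_comm, ← pow_succ', hr, mul_one]

lemma prod_oneSubChar_neg {m : ℕ} [NeZero m] (n : ℕ) (f : ℕ → ZMod m) :
    ∏ i ∈ Finset.range n, oneSubChar (-f i) =
      (-1) ^ n * ZMod.stdAddChar (-∑ i ∈ Finset.range n, f i) *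
        ∏ i ∈ Finset.range n, oneSubChar (f i) := by
  induction n with
  | zero => simp
  | succ n ih =>
    rw [Finset.prod_range_succ, Finset.prod_range_succ, Finset.sum_range_succ, ih, oneSubChar_neg,
      neg_add, AddChar.map_add_eq_mul]
    ring

lemma unit_ne_zero {m : ℕ} (h1 : (1 : ZMod m) ≠ 0) (w : (ZMod m)ˣ) : (w : ZMod m) ≠ 0 :=
  fun h => h1 (by rw [← w.mul_inv, h, zero_mul])

lemma unit_eq_of_oneSubChar_mul_neg {m : ℕ} [NeZero m] (h1 : (1 : ZMod m) ≠ 0) (w z : (ZMod m)ˣ)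
    (h : oneSubChar (w : ZMod m) * oneSubChar (-z : ZMod m) =
      oneSubChar (z : ZMod m) * oneSubChar (-w : ZMod m)) : w = z := by
  rw [oneSubChar_neg, oneSubChar_neg] at h
  have hne := mul_ne_zero (oneSubChar_ne_zero (unit_ne_zero h1 w))
    (oneSubChar_ne_zero (unit_ne_zero h1 z))
  have he : (ZMod.stdAddChar (-w : ZMod m) : ℂ) = ZMod.stdAddChar (-z : ZMod m) := by
    refine mul_right_cancel₀ hne ?_
    linear_combination h
  exact Units.ext (neg_injective (ZMod.injective_stdAddChar he))

lemma prod_oneSubChar_ne_zero {m : ℕ} [NeZero m] (n : ℕ) (f : ℕ → (ZMod m)ˣ) {x : ZMod m}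
    (hx : x ≠ 0) : ∏ i ∈ Finset.range n, oneSubChar ((f i : ZMod m) * x) ≠ 0 :=
  Finset.prod_ne_zero_iff.2 fun _ _ => oneSubChar_unit_mul_ne_zero _ hx

/-- The products of `1 - e(x)` over `wr⁰x, …, wrⁿ⁻¹x` and over `r⁰x, …, rⁿ⁻¹x` agree. -/
def CosetProdEq {m : ℕ} [NeZero m] (n : ℕ) (w r : (ZMod m)ˣ) : Prop :=
  ∀ x : ZMod m, x ≠ 0 →
    ∏ i ∈ Finset.range n, oneSubChar (((w * r ^ i : (ZMod m)ˣ) : ZMod m) * x) =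
      ∏ i ∈ Finset.range n, oneSubChar (((r ^ i : (ZMod m)ˣ) : ZMod m) * x)

lemma cosetProdEq_of_mem {m : ℕ} [NeZero m] {n : ℕ} {w r : (ZMod m)ˣ} (hr : r ^ n = 1)
    (hw : w ∈ Subgroup.zpowers r) : CosetProdEq n w r := fun x _ =>
  prod_range_mul_pow_eq hr hw fun y => oneSubChar ((y : ZMod m) * x)

lemma cosetProdEq_iff_of_neg_mem {m : ℕ} [NeZero m] {n : ℕ} {w r : (ZMod m)ˣ} (hr : r ^ n = 1)
    (hw : -w ∈ Subgroup.zpowers r) : CosetProdEq n w r ↔ ∀ x : ZMod m, x ≠ 0 →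
      (-1) ^ n * (ZMod.stdAddChar (-((∑ i ∈ Finset.range n, (r : ZMod m) ^ i) * x)) : ℂ) = 1 := by
  refine forall₂_congr fun x hx => ?_
  have h1 := prod_range_mul_pow_eq hr hw fun y => oneSubChar (-((y : ZMod m) * x))
  have h2 : ∀ i, oneSubChar (-(((-w * r ^ i : (ZMod m)ˣ) : ZMod m) * x)) =
      oneSubChar (((w * r ^ i : (ZMod m)ˣ) : ZMod m) * x) := by
    intro i
    congr 1
    push_cast
    ring
  simp only [h2] at h1
  rw [h1, prod_oneSubChar_neg, ← Finset.sum_mul, mul_eq_right₀ (prod_oneSubChar_ne_zero _ _ hx)]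
  push_cast
  rfl

lemma cosetProdEq_of_neg_mem {m : ℕ} [NeZero m] {n : ℕ} {w r : (ZMod m)ˣ} (hr : r ^ n = 1)
    (hw : -w ∈ Subgroup.zpowers r) (hn : Even n)
    (hsum : ∑ i ∈ Finset.range n, (r : ZMod m) ^ i = 0) : CosetProdEq n w r := by
  rw [cosetProdEq_iff_of_neg_mem hr hw]
  intro x _
  simp [hn.neg_one_pow, hsum]

lemma CosetProdEq.even_and_sum_eq_zero {m : ℕ} [NeZero m] (hm : 2 < m) {n : ℕ} {w r : (ZMod m)ˣ}
    (hr : r ^ n = 1) (hw : -w ∈ Subgroup.zpowers r) (h : CosetProdEq n w r) :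
    Even n ∧ ∑ i ∈ Finset.range n, (r : ZMod m) ^ i = 0 := by
  rw [cosetProdEq_iff_of_neg_mem hr hw] at h
  have h2 : (2 : ZMod m) ≠ 0 := by
    intro h0
    have := (ZMod.natCast_eq_zero_iff 2 m).1 (by exact_mod_cast h0)
    exact absurd (Nat.le_of_dvd two_pos this) (not_le.2 hm)
  have h1 : (1 : ZMod m) ≠ 0 := by
    intro h0
    exact h2 (by rw [← one_add_one_eq_two, h0, add_zero])
  have e1 := h 1 h1
  have e2 := h 2 h2
  rw [mul_two, neg_add, AddChar.map_add_eq_mul, ← mul_assoc] at e2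
  rw [mul_one] at e1
  rw [e1, one_mul] at e2
  rw [e2, mul_one] at e1
  refine ⟨?_, ?_⟩
  · by_contra hn
    rw [(Nat.not_even_iff_odd.1 hn).neg_one_pow] at e1
    norm_num at e1
  · rw [← neg_eq_zero]
    apply ZMod.injective_stdAddChar
    rw [e2, AddChar.map_zero_eq_one]

lemma gapProdEq_iff_of_pow_eq_one {m : ℕ} [NeZero m] {k : ℕ} {u v : (ZMod m)ˣ}
    (hu : u ^ k = 1) (hv : v ^ k = 1) :
    GapProdEq k u v ↔ CosetProdEq k (u * (u⁻¹ * v)) (u⁻¹ * v) := by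
  refine forall₂_congr fun x hx => ?_
  have hr : (u⁻¹ * v) ^ k = 1 := by rw [mul_pow, inv_pow, hu, hv, inv_one, one_mul]
  have h1 : ∀ i ∈ Finset.range k,
      oneSubChar (((u ^ (k - i) * v ^ (i + 1) : (ZMod m)ˣ) : ZMod m) * x)
      = oneSubChar (((u * (u⁻¹ * v) * (u⁻¹ * v) ^ i : (ZMod m)ˣ) : ZMod m) * x) := by
    intro i hi
    rw [pow_sub _ (Finset.mem_range.1 hi).le, hu, one_mul, mul_inv_cancel_left, mul_pow, inv_pow,
      pow_succ', mul_left_comm]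
  have h2 : ∀ i ∈ Finset.range (k + 1),
      oneSubChar (((u ^ (k - i) * v ^ i : (ZMod m)ˣ) : ZMod m) * x)
      = oneSubChar ((((u⁻¹ * v) ^ i : (ZMod m)ˣ) : ZMod m) * x) := by
    intro i hi
    rw [pow_sub _ (Finset.mem_range_succ_iff.1 hi), hu, one_mul, mul_pow, inv_pow]
  rw [Finset.prod_congr rfl h1, Finset.prod_congr rfl h2, Finset.prod_range_succ, hr, Units.val_one,
    one_mul, mul_comm, mul_left_inj' (oneSubChar_ne_zero hx)]

lemma gapProdEq_iff_of_pow_succ_eq_one {m : ℕ} [NeZero m] {k : ℕ} {u v : (ZMod m)ˣ}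
    (hu : u ^ (k + 1) = 1) :
    GapProdEq k u v ↔ CosetProdEq (k + 1) u⁻¹ (u⁻¹ * v) := by
  refine forall₂_congr fun x _ => ?_
  have huk : u ^ k = u⁻¹ := by rw [eq_inv_iff_mul_eq_one, ← pow_succ, hu]
  have h1 : ∀ i ∈ Finset.range k,
      oneSubChar (((u ^ (k - i) * v ^ (i + 1) : (ZMod m)ˣ) : ZMod m) * x)
      = oneSubChar ((((u⁻¹ * v) ^ (i + 1) : (ZMod m)ˣ) : ZMod m) * x) := by
    intro i hi
    rw [pow_sub _ (Finset.mem_range.1 hi).le, huk, mul_pow, inv_pow, pow_succ u, mul_inv_rev]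
  have h2 : ∀ i ∈ Finset.range (k + 1),
      oneSubChar (((u ^ (k - i) * v ^ i : (ZMod m)ˣ) : ZMod m) * x)
      = oneSubChar (((u⁻¹ * (u⁻¹ * v) ^ i : (ZMod m)ˣ) : ZMod m) * x) := by
    intro i hi
    rw [pow_sub _ (Finset.mem_range_succ_iff.1 hi), huk, mul_pow, inv_pow, mul_assoc]
  rw [Finset.prod_congr rfl h1, Finset.prod_congr rfl h2,
    Finset.prod_range_succ' (fun i => oneSubChar ((((u⁻¹ * v) ^ i : (ZMod m)ˣ) : ZMod m) * x)),
    pow_zero, Units.val_one, one_mul, mul_comm (oneSubChar x), eq_comm]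

lemma GapProdEq.six_term {m : ℕ} [NeZero m] {k : ℕ} {u v : (ZMod m)ˣ} (H : GapProdEq k u v)
    (h1 : (1 : ZMod m) ≠ 0) :
    oneSubChar (u : ZMod m) * oneSubChar ((u ^ (k + 1) * v : (ZMod m)ˣ) : ZMod m) *
        oneSubChar ((v ^ (k + 1) : (ZMod m)ˣ) : ZMod m) =
      oneSubChar (v : ZMod m) * oneSubChar ((u * v ^ (k + 1) : (ZMod m)ˣ) : ZMod m) *
        oneSubChar ((u ^ (k + 1) : (ZMod m)ˣ) : ZMod m) := by
  have key := six_term_of_prod_eq (k := k) (u := u) (v := v)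
    (G := fun w : (ZMod m)ˣ => Units.mk0 (oneSubChar (w : ZMod m))
      (oneSubChar_ne_zero (unit_ne_zero h1 w)))
    fun w => by
      ext
      have := H w (unit_ne_zero h1 w)
      simp only [← Units.val_mul, mul_comm _ w] at this
      simpa only [Units.val_mul, Units.coe_prod, Units.val_mk0] using this
  simpa only [Units.ext_iff, Units.val_mul, Units.val_mk0] using key

lemma GapProdEq.symm {m : ℕ} [NeZero m] {k : ℕ} {u v : (ZMod m)ˣ} (H : GapProdEq k u v) :
    GapProdEq k v u := by
  intro x hx
  have h := H x hx
  rw [← Finset.prod_range_reflect _ k, ← Finset.prod_range_reflect _ (k + 1)] at h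
  convert h using 2
  · refine Finset.prod_congr rfl fun i hi => ?_
    have := Finset.mem_range.1 hi
    rw [mul_comm (v ^ _), show k - (k - 1 - i) = i + 1 by omega,
      show k - 1 - i + 1 = k - i by omega]
  · rename_i i hi
    have := Finset.mem_range.1 hi
    rw [mul_comm (v ^ _), show k - (k + 1 - 1 - i) = i by omega,
      show k + 1 - 1 - i = k - i by omega]

lemma GapProdEq.sum_eq_zero_of_eq_neg_one {m : ℕ} [NeZero m] {k : ℕ} {u v : (ZMod m)ˣ}
    (H : GapProdEq k u v) (hu : u = -1) (h1 : (1 : ZMod m) ≠ 0) :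
    (Even k ∧ ∑ i ∈ Finset.range k, ((u⁻¹ * v : (ZMod m)ˣ) : ZMod m) ^ i = 0) ∨
      (Odd k ∧ ∑ i ∈ Finset.range (k + 1), ((u⁻¹ * v : (ZMod m)ˣ) : ZMod m) ^ i = 0) := by
  have hinv : u⁻¹ = -1 := by rw [hu, inv_neg_one]
  set r := u⁻¹ * v with hr
  have hv : v = -r := by rw [hr, hinv, neg_one_mul, neg_neg]
  have h := H 1 h1
  have hpow : ∀ i ∈ Finset.range k, ((u ^ (k - i) * v ^ (i + 1) : (ZMod m)ˣ) : ZMod m) * 1 =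
      -((-1) ^ k * (r : ZMod m) ^ (i + 1)) := by
    intro i hi
    have hki : k - i + (i + 1) = k + 1 := by
      have := Finset.mem_range.1 hi
      omega
    rw [hu, hv, neg_pow r, ← mul_assoc, ← pow_add, hki]
    push_cast
    ring
  have hpow' : ∀ i ∈ Finset.range k, ((u ^ (k - (i + 1)) * v ^ (i + 1) : (ZMod m)ˣ) : ZMod m) * 1 =
      (-1) ^ k * (r : ZMod m) ^ (i + 1) := by
    intro i hi
    rw [hu, hv, neg_pow r, ← mul_assoc, ← pow_add, Nat.sub_add_cancel (Finset.mem_range.1 hi)]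
    push_cast
    ring
  have hP : ∏ i ∈ Finset.range k, oneSubChar ((-1) ^ k * (r : ZMod m) ^ (i + 1)) ≠ 0 := by
    have := prod_oneSubChar_ne_zero k (fun i => u ^ (k - (i + 1)) * v ^ (i + 1)) h1
    rwa [Finset.prod_congr rfl fun i hi => congrArg oneSubChar (hpow' i hi)] at this
  rw [Finset.prod_range_succ', Finset.prod_congr rfl fun i hi => congrArg oneSubChar (hpow i hi),
    Finset.prod_congr rfl fun i hi => congrArg oneSubChar (hpow' i hi), prod_oneSubChar_neg,
    ← mul_assoc, mul_comm _ (oneSubChar (_ * 1)), mul_left_inj' hP, ← Finset.mul_sum, hu] at h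
  have hg : oneSubChar (1 : ZMod m) ≠ 0 := oneSubChar_ne_zero h1
  rcases Nat.even_or_odd k with hk | hk
  · refine Or.inl ⟨hk, ?_⟩
    simp only [hk.neg_one_pow, one_mul, Nat.sub_zero, pow_zero, mul_one, Units.val_one,
      mul_eq_left₀ hg] at h
    have h0 := ZMod.injective_stdAddChar (h.trans (AddChar.map_zero_eq_one _).symm)
    simp only [pow_succ, ← Finset.sum_mul, neg_eq_zero] at h0
    exact (Units.mul_left_eq_zero r).1 h0
  · refine Or.inr ⟨hk, ?_⟩
    simp only [hk.neg_one_pow, one_mul, Nat.sub_zero, pow_zero, mul_one, Units.val_one,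
      Units.val_neg, neg_mul, neg_neg, oneSubChar_neg, mul_neg, neg_inj] at h
    rw [mul_comm, mul_left_inj' hg] at h
    rw [Finset.sum_range_succ', ZMod.injective_stdAddChar h, pow_zero, neg_add_cancel]

lemma sum_inv_pow_eq_zero {m n : ℕ} {r : (ZMod m)ˣ}
    (h : ∑ i ∈ Finset.range n, ((r⁻¹ : (ZMod m)ˣ) : ZMod m) ^ i = 0) :
    ∑ i ∈ Finset.range n, (r : ZMod m) ^ i = 0 := by
  rw [← Finset.sum_range_reflect]
  rw [← mul_zero ((r : ZMod m) ^ (n - 1)), ← h, Finset.mul_sum]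
  refine Finset.sum_congr rfl fun i hi => ?_
  have hi' : i ≤ n - 1 := Nat.le_sub_one_of_lt (Finset.mem_range.1 hi)
  have := pow_sub r hi'
  rw [← inv_pow] at this
  rw [← Units.val_pow_eq_pow_val, this]
  push_cast
  rfl

lemma pow_eq_one_of_sum_eq_zero {m n : ℕ} {r : (ZMod m)ˣ}
    (h : ∑ i ∈ Finset.range n, (r : ZMod m) ^ i = 0) : r ^ n = 1 := by
  have := geom_sum_mul (r : ZMod m) n
  rw [h, zero_mul, eq_comm, sub_eq_zero] at this
  exact Units.ext (by rw [Units.val_pow_eq_pow_val, this, Units.val_one])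

lemma GapProdEq.symm_sum_eq_zero_of_eq_neg_one {m : ℕ} [NeZero m] {k : ℕ} {u v : (ZMod m)ˣ}
    (H : GapProdEq k u v) (hv : v = -1) (h1 : (1 : ZMod m) ≠ 0) :
    (Even k ∧ ∑ i ∈ Finset.range k, ((u⁻¹ * v : (ZMod m)ˣ) : ZMod m) ^ i = 0) ∨
      (Odd k ∧ ∑ i ∈ Finset.range (k + 1), ((u⁻¹ * v : (ZMod m)ˣ) : ZMod m) ^ i = 0) := by
  have h := H.symm.sum_eq_zero_of_eq_neg_one hv h1
  rw [show v⁻¹ * u = (u⁻¹ * v)⁻¹ by rw [mul_inv_rev, inv_inv]] at h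
  exact h.imp (And.imp_right sum_inv_pow_eq_zero) (And.imp_right sum_inv_pow_eq_zero)

lemma GapProdEq.eq_or_eq_one_of_pow {m : ℕ} [NeZero m] {k : ℕ} {u v : (ZMod m)ˣ}
    (H : GapProdEq k u v) (h1 : (1 : ZMod m) ≠ 0)
    (hu : u ^ k = 1 ∨ u ^ k = -1) (hv : v ^ k = 1 ∨ v ^ k = -1) :
    u = v ∨ u = 1 ∨ v = 1 ∨ (u ^ k = 1 ∧ v ^ k = 1) := by
  have hg := fun w : (ZMod m)ˣ => oneSubChar_ne_zero (unit_ne_zero h1 w)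
  have h := H.six_term h1
  rcases hu with hu | hu <;> rcases hv with hv | hv <;>
    simp only [pow_succ, hu, hv, one_mul, neg_mul, mul_neg, Units.val_neg] at h
  · exact Or.inr (Or.inr (Or.inr ⟨hu, hv⟩))
  · refine Or.inr (Or.inl ?_)
    have := unit_eq_of_oneSubChar_mul_neg h1 (u * v) v
      (mul_right_cancel₀ (hg u) (by linear_combination h))
    exact mul_eq_right.1 this
  · refine Or.inr (Or.inr (Or.inl ?_))
    have := unit_eq_of_oneSubChar_mul_neg h1 u (u * v)
      (mul_right_cancel₀ (hg v) (by linear_combination h))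
    exact mul_eq_left.1 this.symm
  · refine Or.inl (unit_eq_of_oneSubChar_mul_neg h1 u v (mul_right_cancel₀
      (oneSubChar_ne_zero (neg_ne_zero.2 (unit_ne_zero h1 (u * v))))
      (by linear_combination h)))

lemma GapProdEq.eq_or_eq_one_of_pow_succ {m : ℕ} [NeZero m] {k : ℕ} {u v : (ZMod m)ˣ}
    (H : GapProdEq k u v) (h1 : (1 : ZMod m) ≠ 0)
    (hu : u ^ (k + 1) = 1 ∨ u ^ (k + 1) = -1) (hv : v ^ (k + 1) = 1 ∨ v ^ (k + 1) = -1) :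
    u = v ∨ u = 1 ∨ v = 1 ∨ (u ^ (k + 1) = 1 ∧ v ^ (k + 1) = 1) := by
  have hg := fun w : (ZMod m)ˣ => oneSubChar_ne_zero (unit_ne_zero h1 w)
  have h := H.six_term h1
  rcases hu with hu | hu <;> rcases hv with hv | hv <;>
    simp only [hu, hv, one_mul, mul_one, neg_mul, mul_neg, Units.val_neg] at h
  · exact Or.inr (Or.inr (Or.inr ⟨hu, hv⟩))
  · exact Or.inr (Or.inl (unit_eq_of_oneSubChar_mul_neg h1 u 1
      (mul_right_cancel₀ (hg v) (by linear_combination h))))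
  · exact Or.inr (Or.inr (Or.inl
      (unit_eq_of_oneSubChar_mul_neg h1 v 1 (mul_right_cancel₀ (hg u) (by linear_combination -h)))))
  · refine Or.inl (unit_eq_of_oneSubChar_mul_neg h1 u v (mul_right_cancel₀
      (oneSubChar_ne_zero (neg_ne_zero.2 (unit_ne_zero h1 1)))
      (by linear_combination h)))

lemma gapProdEq_of_eq_one_left {m : ℕ} [NeZero m] {k : ℕ} {v : (ZMod m)ˣ} : GapProdEq k 1 v := by
  intro x _
  rw [Finset.prod_range_succ'
      (fun i => oneSubChar (((1 ^ (k - i) * v ^ i : (ZMod m)ˣ) : ZMod m) * x)),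
    mul_comm]
  simp

lemma gapProdEq_neg_one_of_even {m : ℕ} [NeZero m] {k : ℕ} (hk : Even k) (hmk : m ∣ k) :
    GapProdEq k (-1 : (ZMod m)ˣ) (-1) := by
  intro x _
  have h1 : ∀ i ∈ Finset.range k, oneSubChar ((((-1) ^ (k - i) * (-1) ^ (i + 1) : (ZMod m)ˣ) :
      ZMod m) * x) = oneSubChar (-x) := by
    intro i hi
    have hki : k - i + (i + 1) = k + 1 := by
      have := Finset.mem_range.1 hi
      omega
    rw [← pow_add, hki, hk.add_one.neg_one_pow]
    simp
  have h2 : ∀ i ∈ Finset.range (k + 1), oneSubChar ((((-1) ^ (k - i) * (-1) ^ i : (ZMod m)ˣ) :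
      ZMod m) * x) = oneSubChar x := by
    intro i hi
    rw [← pow_add, Nat.sub_add_cancel (Finset.mem_range_succ_iff.1 hi), hk.neg_one_pow]
    simp
  have hk0 : (k : ZMod m) = 0 := (ZMod.natCast_eq_zero_iff k m).2 hmk
  rw [Finset.prod_congr rfl h1, Finset.prod_congr rfl h2, prod_oneSubChar_neg,
    Finset.prod_range_succ]
  simp [hk.neg_one_pow, hk0, mul_comm]

lemma gapProdEq_neg_one_of_odd {m : ℕ} [NeZero m] {k : ℕ} (hk : Odd k) (hmk : m ∣ k + 1) :
    GapProdEq k (-1 : (ZMod m)ˣ) (-1) := by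
  intro x _
  have h1 : ∀ i ∈ Finset.range k, oneSubChar ((((-1) ^ (k - i) * (-1) ^ (i + 1) : (ZMod m)ˣ) :
      ZMod m) * x) = oneSubChar x := by
    intro i hi
    have hki : k - i + (i + 1) = k + 1 := by
      have := Finset.mem_range.1 hi
      omega
    rw [← pow_add, hki, hk.add_one.neg_one_pow]
    simp
  have h2 : ∀ i ∈ Finset.range (k + 1), oneSubChar ((((-1) ^ (k - i) * (-1) ^ i : (ZMod m)ˣ) :
      ZMod m) * x) = oneSubChar (-x) := by
    intro i hi
    rw [← pow_add, Nat.sub_add_cancel (Finset.mem_range_succ_iff.1 hi), hk.neg_one_pow]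
    simp
  have hk0 : ((k + 1 : ℕ) : ZMod m) = 0 := (ZMod.natCast_eq_zero_iff _ m).2 hmk
  rw [Finset.prod_congr rfl h1, Finset.prod_congr rfl h2, prod_oneSubChar_neg,
    Finset.prod_range_succ _ k, Finset.sum_const, Finset.card_range, nsmul_eq_mul, hk0]
  simp [hk.add_one.neg_one_pow, mul_comm]

lemma neg_inv_mem_iff {G : Type*} [Group G] [HasDistribNeg G] {H : Subgroup G} {w : G} :
    -w⁻¹ ∈ H ↔ -w ∈ H := by
  rw [← inv_neg, inv_mem_iff]

lemma neg_mul_self_mem_iff {G : Type*} [Group G] [HasDistribNeg G] {r w : G} :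
    -(w * r) ∈ Subgroup.zpowers r ↔ -w ∈ Subgroup.zpowers r := by
  rw [← neg_mul, Subgroup.mul_mem_cancel_right _ (Subgroup.mem_zpowers r)]

lemma relations_of_sum_eq_zero {m n : ℕ} {u v : (ZMod m)ˣ} (huv : u = -1 ∨ v = -1) (hn : Even n)
    (hsum : ∑ i ∈ Finset.range n, ((u⁻¹ * v : (ZMod m)ˣ) : ZMod m) ^ i = 0) :
    u ^ n = 1 ∧ v ^ n = 1 ∧ -u ∈ Subgroup.zpowers (u⁻¹ * v) := by
  have h := pow_eq_one_of_sum_eq_zero hsum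
  rw [mul_pow, inv_pow, inv_mul_eq_one] at h
  rcases huv with rfl | rfl
  · rw [← h, hn.neg_one_pow, neg_neg]
    exact ⟨rfl, rfl, one_mem _⟩
  · rw [h, hn.neg_one_pow, mul_neg_one, ← inv_neg, Subgroup.zpowers_inv]
    exact ⟨rfl, rfl, Subgroup.mem_zpowers _⟩

lemma GapProdEq.of_eq_neg_one {m : ℕ} [NeZero m] {k : ℕ} {u v : (ZMod m)ˣ}
    (H : GapProdEq k u v) (h1 : (1 : ZMod m) ≠ 0) (huv : u = -1 ∨ v = -1) :
    (u = -1 ∧ v = -1 ∧ Even k ∧ m ∣ k) ∨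
      (u = -1 ∧ v = -1 ∧ Odd k ∧ m ∣ (k + 1)) ∨
      (u ≠ v ∧ u ^ k = 1 ∧ v ^ k = 1 ∧ -u ∈ Subgroup.zpowers (u⁻¹ * v) ∧ Even k ∧
        ∑ i ∈ Finset.range k, ((u⁻¹ * v : (ZMod m)ˣ) : ZMod m) ^ i = 0) ∨
      (u ≠ v ∧ u ^ (k + 1) = 1 ∧ v ^ (k + 1) = 1 ∧ -u ∈ Subgroup.zpowers (u⁻¹ * v) ∧ Odd k ∧
        ∑ i ∈ Finset.range (k + 1), ((u⁻¹ * v : (ZMod m)ˣ) : ZMod m) ^ i = 0) := by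
  have h := huv.elim (fun hu => H.sum_eq_zero_of_eq_neg_one hu h1)
    (fun hv => H.symm_sum_eq_zero_of_eq_neg_one hv h1)
  by_cases hne : u = v
  · subst hne
    have hu : u = -1 := huv.elim id id
    rw [inv_mul_cancel] at h
    simp only [Units.val_one, one_pow, Finset.sum_const, Finset.card_range, nsmul_eq_mul, mul_one,
      ZMod.natCast_eq_zero_iff] at h
    exact h.elim (fun h => Or.inl ⟨hu, hu, h⟩) (fun h => Or.inr (Or.inl ⟨hu, hu, h⟩))
  · rcases h with ⟨hk, hsum⟩ | ⟨hk, hsum⟩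
    · obtain ⟨hu, hv, hmem⟩ := relations_of_sum_eq_zero huv hk hsum
      exact Or.inr (Or.inr (Or.inl ⟨hne, hu, hv, hmem, hk, hsum⟩))
    · obtain ⟨hu, hv, hmem⟩ := relations_of_sum_eq_zero huv hk.add_one hsum
      exact Or.inr (Or.inr (Or.inr ⟨hne, hu, hv, hmem, hk, hsum⟩))

lemma gapProdEq_iff {m : ℕ} [NeZero m] {k : ℕ} (hk : 0 < k) {u v r : (ZMod m)ˣ}
    (hr : r = u⁻¹ * v) : GapProdEq k u v ↔
      ((u = 1 ∨ v = 1) ∨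
        (u = -1 ∧ v = -1 ∧ Even k ∧ m ∣ k) ∨
        (u = -1 ∧ v = -1 ∧ Odd k ∧ m ∣ (k + 1)) ∨
        (u ≠ v ∧ u ^ k = 1 ∧ v ^ k = 1 ∧ u ∈ Subgroup.zpowers r) ∨
        (u ≠ v ∧ u ^ k = 1 ∧ v ^ k = 1 ∧ -u ∈ Subgroup.zpowers r ∧ Even k ∧
          ∑ i ∈ Finset.range k, (r : ZMod m) ^ i = 0) ∨
        (u ≠ v ∧ u ^ (k + 1) = 1 ∧ v ^ (k + 1) = 1 ∧ u ∈ Subgroup.zpowers r) ∨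
        (u ≠ v ∧ u ^ (k + 1) = 1 ∧ v ^ (k + 1) = 1 ∧ -u ∈ Subgroup.zpowers r ∧ Odd k ∧
          ∑ i ∈ Finset.range (k + 1), (r : ZMod m) ^ i = 0)) := by
  have hpow : ∀ {n : ℕ}, u ^ n = 1 → v ^ n = 1 → r ^ n = 1 := by
    intro n hu hv
    rw [hr, mul_pow, inv_pow, hu, hv, inv_one, one_mul]
  constructor
  · intro H
    rcases le_or_gt m 2 with hm | hm
    · have hm0 := NeZero.pos m
      refine Or.inl (Or.inl ?_)
      clear hr hpow H
      interval_cases m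
      · exact Subsingleton.elim _ _
      · revert u
        decide
    have : Fact (1 < m) := ⟨by omega⟩
    have h1 : (1 : ZMod m) ≠ 0 := one_ne_zero
    subst hr
    by_cases hneg : u = -1 ∨ v = -1
    · rcases H.of_eq_neg_one h1 hneg with h | h | h | h
      · exact Or.inr (Or.inl h)
      · exact Or.inr (Or.inr (Or.inl h))
      · exact Or.inr (Or.inr (Or.inr (Or.inr (Or.inl h))))
      · exact Or.inr (Or.inr (Or.inr (Or.inr (Or.inr (Or.inr h)))))
    by_cases hone : u = 1 ∨ v = 1
    · exact Or.inl hone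
    obtain ⟨hu1, hv1⟩ := not_or.1 hone
    obtain ⟨hu2, hv2⟩ := not_or.1 hneg
    have hne : (u ∈ Subgroup.zpowers (u⁻¹ * v) ∨ -u ∈ Subgroup.zpowers (u⁻¹ * v)) → u ≠ v := by
      rintro hmem rfl
      rw [inv_mul_cancel, Subgroup.zpowers_one_eq_bot, Subgroup.mem_bot, Subgroup.mem_bot,
        neg_eq_iff_eq_neg] at hmem
      exact hmem.elim hu1 hu2
    right; right; right
    rcases relations_of_prod_eq hk H with h | h | ⟨hu, hv, hmem⟩ | ⟨hu, hv, hmem⟩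
    · exact absurd h (not_or.2 ⟨hu1, hu2⟩)
    · exact absurd h (not_or.2 ⟨hv1, hv2⟩)
    · have huv := hne hmem
      obtain ⟨hu, hv⟩ := (((H.eq_or_eq_one_of_pow h1 hu hv).resolve_left huv).resolve_left
        hu1).resolve_left hv1
      rcases hmem with hmem | hmem
      · exact Or.inl ⟨huv, hu, hv, hmem⟩
      · exact Or.inr (Or.inl ⟨huv, hu, hv, hmem,
          ((gapProdEq_iff_of_pow_eq_one hu hv).1 H).even_and_sum_eq_zero hm (hpow hu hv)
            (neg_mul_self_mem_iff.2 hmem)⟩)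
    · have huv := hne hmem
      obtain ⟨hu, hv⟩ := (((H.eq_or_eq_one_of_pow_succ h1 hu hv).resolve_left huv).resolve_left
        hu1).resolve_left hv1
      rcases hmem with hmem | hmem
      · exact Or.inr (Or.inr (Or.inl ⟨huv, hu, hv, hmem⟩))
      · obtain ⟨heven, hsum⟩ := ((gapProdEq_iff_of_pow_succ_eq_one hu).1 H).even_and_sum_eq_zero hm
          (hpow hu hv) (neg_inv_mem_iff.2 hmem)
        rw [Nat.even_add_one, Nat.not_even_iff_odd] at heven
        exact Or.inr (Or.inr (Or.inr ⟨huv, hu, hv, hmem, heven, hsum⟩))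
  · rintro ((rfl | rfl) | ⟨rfl, rfl, hk', hmk⟩ | ⟨rfl, rfl, hk', hmk⟩ | ⟨-, hu, hv, hmem⟩ |
      ⟨-, hu, hv, hmem, hk', hsum⟩ | ⟨-, hu, hv, hmem⟩ | ⟨-, hu, hv, hmem, hk', hsum⟩)
    · exact gapProdEq_of_eq_one_left
    · exact gapProdEq_of_eq_one_left.symm
    · exact gapProdEq_neg_one_of_even hk' hmk
    · exact gapProdEq_neg_one_of_odd hk' hmk
    · rw [gapProdEq_iff_of_pow_eq_one hu hv, ← hr]
      exact cosetProdEq_of_mem (hpow hu hv) (mul_mem hmem (Subgroup.mem_zpowers r))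
    · rw [gapProdEq_iff_of_pow_eq_one hu hv, ← hr]
      exact cosetProdEq_of_neg_mem (hpow hu hv) (neg_mul_self_mem_iff.2 hmem) hk' hsum
    · rw [gapProdEq_iff_of_pow_succ_eq_one hu, ← hr]
      exact cosetProdEq_of_mem (hpow hu hv) (inv_mem hmem)
    · rw [gapProdEq_iff_of_pow_succ_eq_one hu, ← hr]
      exact cosetProdEq_of_neg_mem (hpow hu hv) (neg_inv_mem_iff.2 hmem) hk'.add_one hsum

theorem stmt_16 (a b k m : ℕ) (ha : 2 ≤ a) (hb : 2 ≤ b) (hk : 0 < k) (hm : 0 < m)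
    (hab : Nat.Coprime a b) (habm : Nat.Coprime (a * b) m)
    (u v r : (ZMod m)ˣ)
    (hu : (u : ZMod m) = (a : ZMod m)) (hv : (v : ZMod m) = (b : ZMod m))
    (hr : r = u⁻¹ * v) :
    EquidistMod {n : ℕ | n ∉ geomNS a b k} m ↔
      ((u = 1 ∨ v = 1) ∨
        (u = -1 ∧ v = -1 ∧ Even k ∧ m ∣ k) ∨
        (u = -1 ∧ v = -1 ∧ Odd k ∧ m ∣ (k + 1)) ∨
        (u ≠ v ∧ u ^ k = 1 ∧ v ^ k = 1 ∧ u ∈ Subgroup.zpowers r) ∨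
        (u ≠ v ∧ u ^ k = 1 ∧ v ^ k = 1 ∧ -u ∈ Subgroup.zpowers r ∧ Even k ∧
          ∑ i ∈ Finset.range k, (r : ZMod m) ^ i = 0) ∨
        (u ≠ v ∧ u ^ (k + 1) = 1 ∧ v ^ (k + 1) = 1 ∧ u ∈ Subgroup.zpowers r) ∨
        (u ≠ v ∧ u ^ (k + 1) = 1 ∧ v ^ (k + 1) = 1 ∧ -u ∈ Subgroup.zpowers r ∧ Odd k ∧
          ∑ i ∈ Finset.range (k + 1), (r : ZMod m) ^ i = 0)) := by
  have : NeZero m := ⟨hm.ne'⟩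
  rw [equidistMod_gaps_iff (by omega) hab k hu hv, gapProdEq_iff hk hr]
end
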